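/- The cone cBCCat of the extended Catalan arrangement of type BC_N is a free arrangement: the module of logarithmic vector fields on ℂ^{N+1} = {(x_1,…,x_N,z)} — vector fields L = Σ_{i=1}^N g_i ∂_{x_i} + g_0 ∂_z with polynomial coefficients such that ℓ divides L(ℓ) for every defining linear form ℓ of a hyperplane of cBCCat — is a free ℂ[x_1,…,x_N,z]-module of rank N+1. -/

import Mathlib

open MvPolynomial

noncomputable section

/-- Membership in `D(cBCCat)`: the logarithmic conditions along all hyperplanes of the
cone `cBCCat` of the extended Catalan arrangement of type `BC_N`.  A vector field on
`ℂ^{N+1}` is encoded by its coefficients `g : Fin (N+1) → ℂ[x_1,…,x_N,z]`, the index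
`Fin.castSucc i` corresponding to `∂_{x_i}` and the last index to `∂_z`; for a linear form
`ℓ`, `L(ℓ)` is the corresponding combination of the `g_i`. -/
def DcBCCat (N : ℕ) (m1 m2 m3 : ℕ) :
    Set (Fin (N + 1) → MvPolynomial (Fin (N + 1)) ℂ) :=
  {g | -- the hyperplane `z = 0`
       (MvPolynomial.X (Fin.last N) ∣ g (Fin.last N)) ∧
       -- the hyperplanes `x_i = j z`, `-m1 ≤ j ≤ m1`
       (∀ i : Fin N, ∀ j : ℤ, -(m1 : ℤ) ≤ j → j ≤ (m1 : ℤ) →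
          (MvPolynomial.X (Fin.castSucc i)
              - MvPolynomial.C (j : ℂ) * MvPolynomial.X (Fin.last N)) ∣
            (g (Fin.castSucc i) - MvPolynomial.C (j : ℂ) * g (Fin.last N))) ∧
       -- the hyperplanes `2x_i = ±(2j−1) z`, `1 ≤ j ≤ m2`
       (∀ i : Fin N, ∀ j : ℕ, 1 ≤ j → j ≤ m2 →
          ((MvPolynomial.C 2 * MvPolynomial.X (Fin.castSucc i)
              - MvPolynomial.C (2 * (j : ℂ) - 1) * MvPolynomial.X (Fin.last N)) ∣
            (MvPolynomial.C 2 * g (Fin.castSucc i)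
              - MvPolynomial.C (2 * (j : ℂ) - 1) * g (Fin.last N))) ∧
          ((MvPolynomial.C 2 * MvPolynomial.X (Fin.castSucc i)
              + MvPolynomial.C (2 * (j : ℂ) - 1) * MvPolynomial.X (Fin.last N)) ∣
            (MvPolynomial.C 2 * g (Fin.castSucc i)
              + MvPolynomial.C (2 * (j : ℂ) - 1) * g (Fin.last N)))) ∧
       -- the hyperplanes `x_i − εx_j = k z`, `ε = ±1`, `-m3 ≤ k ≤ m3`
       (∀ i j : Fin N, i < j → ∀ k : ℤ, -(m3 : ℤ) ≤ k → k ≤ (m3 : ℤ) →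
          ((MvPolynomial.X (Fin.castSucc i) - MvPolynomial.X (Fin.castSucc j)
              - MvPolynomial.C (k : ℂ) * MvPolynomial.X (Fin.last N)) ∣
            (g (Fin.castSucc i) - g (Fin.castSucc j)
              - MvPolynomial.C (k : ℂ) * g (Fin.last N))) ∧
          ((MvPolynomial.X (Fin.castSucc i) + MvPolynomial.X (Fin.castSucc j)
              - MvPolynomial.C (k : ℂ) * MvPolynomial.X (Fin.last N)) ∣
            (g (Fin.castSucc i) + g (Fin.castSucc j)
              - MvPolynomial.C (k : ℂ) * g (Fin.last N))))}

/-- `DegLE p e` says that every monomial of `p` has total degree at most the integer `e`;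
in particular `p = 0` when `e < 0`. -/
def DegLE {σ : Type*} (p : MvPolynomial σ ℂ) (e : ℤ) : Prop :=
  ∀ m ∈ p.support, (m.degree : ℤ) ≤ e

namespace DegLE

variable {σ τ : Type*} {p q : MvPolynomial σ ℂ} {d e : ℤ}

theorem zero : DegLE (0 : MvPolynomial σ ℂ) e := by simp [DegLE]

theorem mono (h : DegLE p d) (hde : d ≤ e) : DegLE p e := fun m hm => (h m hm).trans hde

theorem add (hp : DegLE p e) (hq : DegLE q e) : DegLE (p + q) e := by
  classical
  intro m hm
  rcases Finset.mem_union.1 (MvPolynomial.support_add hm) with h | h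
  exacts [hp m h, hq m h]

theorem neg (hp : DegLE p e) : DegLE (-p) e := by
  intro m hm
  exact hp m (by simpa using hm)

theorem sub (hp : DegLE p e) (hq : DegLE q e) : DegLE (p - q) e := by
  rw [sub_eq_add_neg]; exact hp.add hq.neg

theorem sum {ι : Type*} {s : Finset ι} {f : ι → MvPolynomial σ ℂ}
    (h : ∀ i ∈ s, DegLE (f i) e) : DegLE (∑ i ∈ s, f i) e := by
  classical
  induction s using Finset.induction_on with
  | empty => simpa using zero
  | insert a s ha ih =>
    rw [Finset.sum_insert ha]
    exact (h a (by simp)).add (ih fun i hi => h i (by simp [hi]))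

theorem mul (hp : DegLE p d) (hq : DegLE q e) : DegLE (p * q) (d + e) := by
  classical
  intro m hm
  obtain ⟨a, ha, b, hb, rfl⟩ := Finset.mem_add.1 (MvPolynomial.support_mul p q hm)
  have := hp a ha
  have := hq b hb
  simp only [map_add]
  push_cast
  omega

theorem C (a : ℂ) (he : 0 ≤ e) : DegLE (MvPolynomial.C a : MvPolynomial σ ℂ) e := by
  classical
  intro m hm
  have : m = 0 := by
    by_contra h
    simp [MvPolynomial.coeff_C, Ne.symm h] at hm
  simpa [this] using he

theorem one (he : 0 ≤ e) : DegLE (1 : MvPolynomial σ ℂ) e := by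
  simpa using DegLE.C (σ := σ) 1 he

theorem X (i : σ) (he : 1 ≤ e) : DegLE (MvPolynomial.X i : MvPolynomial σ ℂ) e := by
  classical
  intro m hm
  have : Finsupp.single i 1 = m := by
    by_contra h
    simp [MvPolynomial.coeff_X, h] at hm
  simpa [← this] using he

theorem C_mul (a : ℂ) (hp : DegLE p e) : DegLE (MvPolynomial.C a * p) e := by
  simpa using (DegLE.C a le_rfl).mul hp

theorem prod {ι : Type*} {s : Finset ι} {f : ι → MvPolynomial σ ℂ} {d : ι → ℤ}
    (h : ∀ i ∈ s, DegLE (f i) (d i)) : DegLE (∏ i ∈ s, f i) (∑ i ∈ s, d i) := by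
  classical
  induction s using Finset.induction_on with
  | empty => simpa using one le_rfl
  | insert a s ha ih =>
    rw [Finset.prod_insert ha, Finset.sum_insert ha]
    exact (h a (by simp)).mul (ih fun i hi => h i (by simp [hi]))

theorem pow (hp : DegLE p e) (n : ℕ) : DegLE (p ^ n) (n * e) := by
  simpa using prod (s := Finset.range n) (f := fun _ => p) (d := fun _ => e) (fun _ _ => hp)

/-- Substituting polynomials of degree at most one does not raise the degree. -/
theorem aeval {f : σ → MvPolynomial τ ℂ} (hf : ∀ i, DegLE (f i) 1) (hp : DegLE p e) :
    DegLE (MvPolynomial.aeval f p) e := by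
  rw [MvPolynomial.aeval_def, MvPolynomial.eval₂_eq]
  refine sum fun m hm => ?_
  refine (DegLE.C_mul (p.coeff m) (prod (d := fun i => (m i : ℤ)) fun i _ => ?_)).mono ?_
  · simpa using (hf i).pow (m i)
  · have := hp m hm
    rw [Finsupp.degree_apply] at this
    push_cast at this
    exact this

theorem rename (f : σ → τ) (hp : DegLE p e) : DegLE (MvPolynomial.rename f p) e := by
  have : MvPolynomial.rename f = MvPolynomial.aeval (R := ℂ) (MvPolynomial.X ∘ f) :=
    MvPolynomial.algHom_ext (by simp)
  rw [this]
  exact hp.aeval fun i => X _ le_rfl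

theorem iff_totalDegree : DegLE p e ↔ p = 0 ∨ (p.totalDegree : ℤ) ≤ e := by
  constructor
  · intro h
    by_cases hp : p = 0
    · exact Or.inl hp
    · right
      obtain ⟨m, hm, hmd⟩ := Finset.exists_mem_eq_sup p.support
        (MvPolynomial.support_nonempty.2 hp) (fun m => m.sum fun _ e => e)
      have := h m hm
      rw [MvPolynomial.totalDegree, hmd]
      exact this
  · rintro (rfl | h)
    · exact zero
    · intro m hm
      have : m.degree ≤ p.totalDegree := MvPolynomial.le_totalDegree hm
      omega

theorem eq_zero (hp : DegLE p e) (he : e < 0) : p = 0 := by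
  rcases iff_totalDegree.1 hp with h | h
  · exact h
  · omega

/-- A nonzero factor of known total degree lowers the degree bound of the cofactor. -/
theorem of_mul (hq : q ≠ 0) (h : DegLE (q * p) e) : DegLE p (e - q.totalDegree) := by
  by_cases hp : p = 0
  · rw [hp]; exact zero
  · rcases iff_totalDegree.1 h with h | h
    · simp [hp, hq] at h
    · rw [MvPolynomial.totalDegree_mul_of_isDomain hq hp] at h
      push_cast at h
      exact iff_totalDegree.2 (Or.inr (by omega))

theorem exists_C (hp : DegLE p e) (he : e ≤ 0) : ∃ a, p = MvPolynomial.C a := by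
  rcases iff_totalDegree.1 hp with h | h
  · exact ⟨0, by simp [h]⟩
  · exact ⟨_, MvPolynomial.totalDegree_eq_zero_iff_eq_C.1 (by omega)⟩

end DegLE

section Hyperplane

variable {σ : Type*} [DecidableEq σ]

/-- The polynomial `q` does not involve the variable `X i`. -/
def IndepOf (i : σ) (q : MvPolynomial σ ℂ) : Prop :=
  ∀ (x : σ → ℂ) (a : ℂ), eval (Function.update x i a) q = eval x q

/-- Substitution of `q` for the variable `X i`. -/
def substVar (i : σ) (q : MvPolynomial σ ℂ) : MvPolynomial σ ℂ →ₐ[ℂ] MvPolynomial σ ℂ :=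
  aeval (Function.update X i q)

theorem eval_substVar (i : σ) (q p : MvPolynomial σ ℂ) (x : σ → ℂ) :
    eval x (substVar i q p) = eval (Function.update x i (eval x q)) p := by
  have : (aeval x).comp (substVar i q) = aeval (R := ℂ) (Function.update x i (eval x q)) := by
    apply MvPolynomial.algHom_ext
    intro j
    by_cases h : j = i
    · subst h; simp [substVar]
    · simp [substVar, h]
  simpa [MvPolynomial.coe_aeval_eq_eval] using DFunLike.congr_fun this p

theorem dvd_sub_substVar (i : σ) (q p : MvPolynomial σ ℂ) :
    X i - q ∣ p - substVar i q p := by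
  induction p using MvPolynomial.induction_on with
  | C a => simp [substVar]
  | add f g hf hg =>
    rw [map_add, add_sub_add_comm]
    exact dvd_add hf hg
  | mul_X f j hf =>
    have h2 : X i - q ∣ X j - substVar i q (X j) := by
      by_cases h : j = i
      · subst h; simp [substVar]
      · simp [substVar, h]
    have : f * X j - substVar i q (f * X j) =
        (f - substVar i q f) * X j + substVar i q f * (X j - substVar i q (X j)) := by
      rw [map_mul]; ring
    rw [this]
    exact dvd_add (hf.mul_right _) (h2.mul_left _)

theorem substVar_self {i : σ} {q : MvPolynomial σ ℂ} (hq : IndepOf i q) :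
    substVar i q (X i - q) = 0 := by
  apply MvPolynomial.funext
  intro x
  simp [eval_substVar, hq x]

theorem sub_dvd_iff {i : σ} {q : MvPolynomial σ ℂ} (hq : IndepOf i q) (p : MvPolynomial σ ℂ) :
    X i - q ∣ p ↔ substVar i q p = 0 := by
  constructor
  · rintro ⟨r, rfl⟩
    rw [map_mul, substVar_self hq, zero_mul]
  · intro h
    simpa [h] using dvd_sub_substVar i q p

theorem sub_dvd_iff_eval {i : σ} {q : MvPolynomial σ ℂ} (hq : IndepOf i q)
    (p : MvPolynomial σ ℂ) :
    X i - q ∣ p ↔ ∀ x : σ → ℂ, x i = eval x q → eval x p = 0 := by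
  rw [sub_dvd_iff hq]
  constructor
  · intro h x hx
    have := congrArg (eval x) h
    rwa [eval_substVar, ← hx, Function.update_eq_self, map_zero] at this
  · intro h
    apply MvPolynomial.funext
    intro x
    rw [eval_substVar, map_zero]
    exact h _ (by simp [hq x])

theorem sub_ne_zero_of_indepOf {i : σ} {q : MvPolynomial σ ℂ} (hq : IndepOf i q) :
    (X i - q : MvPolynomial σ ℂ) ≠ 0 := by
  intro h
  have := congrArg (eval (Function.update 0 i (eval 0 q + 1))) h
  simp [hq 0] at this

theorem prime_sub {i : σ} {q : MvPolynomial σ ℂ} (hq : IndepOf i q) :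
    Prime (X i - q : MvPolynomial σ ℂ) := by
  refine ⟨sub_ne_zero_of_indepOf hq, ?_, ?_⟩
  · intro h
    have := h.map (substVar i q)
    rw [substVar_self hq] at this
    exact not_isUnit_zero this
  · intro a b h
    rw [sub_dvd_iff hq, map_mul, mul_eq_zero] at h
    rwa [sub_dvd_iff hq, sub_dvd_iff hq]

end Hyperplane

theorem Finset.prod_dvd_of_prime {ι R : Type*} [CommRing R] [IsDomain R] {s : Finset ι}
    {f : ι → R} {p : R} (hf : ∀ i ∈ s, Prime (f i))
    (hne : ∀ i ∈ s, ∀ j ∈ s, i ≠ j → ¬ f i ∣ f j) (hp : ∀ i ∈ s, f i ∣ p) :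
    ∏ i ∈ s, f i ∣ p := by
  classical
  induction s using Finset.induction_on generalizing p with
  | empty => simp
  | insert a s ha ih =>
    obtain ⟨r, rfl⟩ := hp a (by simp)
    rw [Finset.prod_insert ha]
    refine mul_dvd_mul_left _ (ih (fun i hi => hf i (by simp [hi]))
      (fun i hi j hj => hne i (by simp [hi]) j (by simp [hj])) fun i hi => ?_)
    rcases (hf i (by simp [hi])).dvd_or_dvd (hp i (by simp [hi])) with h | h
    · exact absurd h (hne i (by simp [hi]) a (by simp) (by rintro rfl; exact ha hi))
    · exact h

theorem DegLE.det {σ : Type*} {n : ℕ} {M : Matrix (Fin n) (Fin n) (MvPolynomial σ ℂ)}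
    {d : Fin n → ℤ} (h : ∀ k i, DegLE (M k i) (d k)) : DegLE M.det (∑ k, d k) := by
  rw [← Matrix.det_transpose, Matrix.det_apply]
  refine DegLE.sum fun s _ => ?_
  have : DegLE (∏ i, M.transpose (s i) i) (∑ k, d k) :=
    DegLE.prod fun i _ => h i (s i)
  rcases Int.units_eq_one_or (Equiv.Perm.sign s) with h | h <;> rw [h]
  · simpa using this
  · simpa using this.neg

theorem dvd_det_of_dvd {R : Type*} [CommRing R] {n : ℕ} {ℓ : R} (hℓ : Prime ℓ)
    {M : Matrix (Fin n) (Fin n) R} {w : Fin n → R} {i₀ : Fin n} (hw : w i₀ = 1)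
    (h : ∀ k, ℓ ∣ ∑ i, w i * M k i) : ℓ ∣ M.det := by
  have hprime : (Ideal.span {ℓ}).IsPrime := (Ideal.span_singleton_prime hℓ.ne_zero).2 hℓ
  rw [← Ideal.mem_span_singleton, ← Ideal.Quotient.eq_zero_iff_mem, RingHom.map_det,
    ← Matrix.exists_mulVec_eq_zero_iff]
  refine ⟨fun i => Ideal.Quotient.mk _ (w i), ?_, ?_⟩
  · intro h0
    have := congrFun h0 i₀
    simp [hw] at this
  · ext k
    have := h k
    rw [← Ideal.mem_span_singleton, ← Ideal.Quotient.eq_zero_iff_mem] at this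
    simpa [Matrix.mulVec, dotProduct, mul_comm] using this

theorem totalDegree_prod_of_ne_zero {σ ι : Type*} {s : Finset ι} {f : ι → MvPolynomial σ ℂ}
    (h : ∀ i ∈ s, f i ≠ 0) : (∏ i ∈ s, f i).totalDegree = ∑ i ∈ s, (f i).totalDegree := by
  classical
  induction s using Finset.induction_on with
  | empty => simp
  | insert a s ha ih =>
    have hs : ∀ i ∈ s, f i ≠ 0 := fun i hi => h i (by simp [hi])
    rw [Finset.prod_insert ha, Finset.sum_insert ha, totalDegree_mul_of_isDomain (h a (by simp))
      (Finset.prod_ne_zero_iff.2 hs), ih hs]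

/-- Saito's criterion: independent logarithmic fields whose degrees sum up to the number of
hyperplanes generate all logarithmic fields. -/
theorem saito {σ H : Type*} [Fintype H] {n : ℕ} (ℓ : H → MvPolynomial σ ℂ)
    (w : H → Fin n → MvPolynomial σ ℂ) (hw : ∀ h, ∃ i, w h i = 1)
    (hprime : ∀ h, Prime (ℓ h)) (hne : ∀ h h', h ≠ h' → ¬ ℓ h ∣ ℓ h')
    (hdeg : ∀ h, (ℓ h).totalDegree = 1)
    (θ : Fin n → Fin n → MvPolynomial σ ℂ) (d : Fin n → ℤ) (hθd : ∀ k i, DegLE (θ k i) (d k))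
    (hθ : ∀ k h, ℓ h ∣ ∑ i, w h i * θ k i) (hsum : ∑ k, d k ≤ Fintype.card H)
    (hdet : Matrix.det (Matrix.of θ) ≠ 0)
    (v : Fin n → MvPolynomial σ ℂ) (hv : ∀ h, ℓ h ∣ ∑ i, w h i * v i) :
    ∃ a : Fin n → MvPolynomial σ ℂ, (∀ i, v i = ∑ k, a k * θ k i) ∧
      ∀ e, (∀ i, DegLE (v i) e) → ∀ k, DegLE (a k) (e - d k) := by
  classical
  set M : Matrix (Fin n) (Fin n) (MvPolynomial σ ℂ) := Matrix.of θ with hM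
  set Q := ∏ h, ℓ h with hQ
  have hQ0 : Q ≠ 0 := Finset.prod_ne_zero_iff.2 fun h _ => (hprime h).ne_zero
  have hQdeg : Q.totalDegree = Fintype.card H := by
    rw [hQ, totalDegree_prod_of_ne_zero fun h _ => (hprime h).ne_zero]
    simp [hdeg]
  have hQdvd : ∀ A : Matrix (Fin n) (Fin n) (MvPolynomial σ ℂ),
      (∀ k h, ℓ h ∣ ∑ i, w h i * A k i) → Q ∣ A.det := fun A hA =>
    Finset.prod_dvd_of_prime (fun h _ => hprime h) (fun h _ h' _ => hne h h') fun h _ => by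
      obtain ⟨i₀, hi₀⟩ := hw h
      exact dvd_det_of_dvd (hprime h) hi₀ fun k => hA k h
  obtain ⟨r, hr⟩ := hQdvd M hθ
  have hdr : DegLE r 0 := by
    have := DegLE.det (M := M) hθd
    rw [hr] at this
    exact (this.of_mul hQ0).mono (by omega)
  obtain ⟨γ, rfl⟩ := hdr.exists_C le_rfl
  have hγ : γ ≠ 0 := by
    rintro rfl
    simp at hr
    exact hdet hr
  have hrow : ∀ k, ∀ k' h, ℓ h ∣ ∑ i, w h i * M.updateRow k v k' i := by
    intro k k' h
    by_cases hk : k' = k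
    · subst hk; simpa using hv h
    · simpa [Matrix.updateRow_ne hk, hM] using hθ k' h
  choose b hb using fun k => hQdvd _ (hrow k)
  refine ⟨fun k => C γ⁻¹ * b k, fun i => ?_, fun e he k => ?_⟩
  · have hcr := congrFun (Matrix.mulVec_cramer M.transpose v) i
    simp only [Matrix.mulVec, dotProduct, Matrix.det_transpose, Matrix.cramer_transpose_apply,
      Matrix.transpose_apply, Pi.smul_apply, smul_eq_mul] at hcr
    have h1 : Q * C γ * v i = ∑ k, θ k i * (Q * b k) := by
      rw [← hr, ← hcr]
      exact Finset.sum_congr rfl fun k _ => by rw [hb k]; rfl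
    have h2 : C γ * v i = ∑ k, θ k i * b k := by
      apply mul_left_cancel₀ hQ0
      rw [← mul_assoc, h1, Finset.mul_sum]
      exact Finset.sum_congr rfl fun k _ => by ring
    have h3 : v i = C γ⁻¹ * (C γ * v i) := by
      rw [← mul_assoc, ← C_mul, inv_mul_cancel₀ hγ, C_1, one_mul]
    rw [h3, h2, Finset.mul_sum]
    exact Finset.sum_congr rfl fun k _ => by ring
  · refine DegLE.C_mul _ ?_
    have h1 : DegLE (Q * b k) (∑ k', Function.update d k e k') := by
      rw [← hb k]
      refine DegLE.det fun k' i => ?_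
      by_cases hk : k' = k
      · subst hk; simpa using he i
      · simpa [Matrix.updateRow_ne hk, hk, hM] using hθd k' i
    rw [Finset.sum_update_of_mem (Finset.mem_univ k)] at h1
    refine (h1.of_mul hQ0).mono ?_
    rw [hQdeg]
    have := Finset.sum_sdiff_eq_sub (f := d) (Finset.subset_univ {k})
    simp only [Finset.sum_singleton] at this
    omega

/-- The sign attached to an ordered pair of indices: ordered pairs encode both families
`x_i - x_j` and `x_i + x_j`. -/
def pairSign {n : ℕ} (i j : Fin n) : ℂ := if i < j then 1 else -1

/-- Index set for the hyperplanes `x_i = c`, `c ∈ C`, and `x_i ± x_j = k`, `|k| ≤ m`. -/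
abbrev HypIndex (n : ℕ) (C : Finset ℂ) (m : ℕ) : Type :=
  (Fin n × C) ⊕ ({p : Fin n × Fin n // p.1 ≠ p.2} × Finset.Icc (-(m : ℤ)) m)

namespace HypIndex

variable {n m : ℕ} {C : Finset ℂ}

theorem card : (Fintype.card (HypIndex n C m) : ℤ) = n * C.card + n * (n - 1) * (2 * m + 1) := by
  have h : Fintype.card {p : Fin n × Fin n // p.1 ≠ p.2} = n * n - n := by
    rw [Fintype.card_subtype]
    have h : (Finset.univ.filter fun p : Fin n × Fin n => p.1 ≠ p.2) = Finset.univ.offDiag := by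
      ext; simp
    rw [h, Finset.offDiag_card, Finset.card_univ, Fintype.card_fin]
  have hle : n ≤ n * n := Nat.le_mul_self n
  simp only [Fintype.card_sum, Fintype.card_prod, Fintype.card_fin, Fintype.card_coe, h,
    Int.card_Icc]
  push_cast [Nat.cast_sub hle]
  rw [Int.toNat_of_nonneg (by omega)]
  ring

/-- The affine equation of a hyperplane. -/
def aff (h : HypIndex n C m) (x : Fin n → ℂ) : ℂ :=
  match h with
  | .inl (i, c) => x i - c
  | .inr (p, k) => x p.1.1 - pairSign p.1.1 p.1.2 * x p.1.2 - ((k : ℤ) : ℂ)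

theorem pairSign_ne_zero {i j : Fin n} : pairSign i j ≠ 0 := by
  unfold pairSign; split_ifs <;> simp

theorem eq_of_aff_imp {h h' : HypIndex n C m} (H : ∀ x, aff h x = 0 → aff h' x = 0) :
    h = h' := by
  rcases h with ⟨i, c⟩ | ⟨⟨⟨i, j⟩, hij⟩, k⟩ <;> rcases h' with ⟨i', c'⟩ | ⟨⟨⟨i', j'⟩, hij'⟩, k'⟩
  · have h1 := H (Function.update (fun _ => (c' : ℂ) + 1) i c) (by simp [aff])
    by_cases hi : i' = i
    · subst hi
      simp only [aff, Function.update_self, sub_eq_zero] at h1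
      rw [Subtype.ext h1]
    · simp [aff, hi] at h1
  · exfalso
    obtain ⟨l, hl, hli⟩ : ∃ l, (l = i' ∨ l = j') ∧ l ≠ i := by
      by_cases h : i' = i
      · exact ⟨j', Or.inr rfl, fun h' => hij' (by simp [h, h'])⟩
      · exact ⟨i', Or.inl rfl, h⟩
    have key : ∀ t, aff (.inr (⟨(i', j'), hij'⟩, k') : HypIndex n C m)
        (Function.update (Function.update 0 i (c : ℂ)) l t) = 0 := fun t =>
      H _ (by simp [aff, Function.update_of_ne hli.symm])
    have h0 := key 0
    have h1 := key 1
    have hs := pairSign_ne_zero (i := i') (j := j')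
    simp only at hij'
    rcases hl with rfl | rfl
    · simp only [aff, Function.update_self, Function.update_of_ne (Ne.symm hij')] at h0 h1
      have : (1 : ℂ) = 0 := by linear_combination h1 - h0
      simp at this
    · simp only [aff, Function.update_self, Function.update_of_ne hij'] at h0 h1
      exact hs (by linear_combination h0 - h1)
  · exfalso
    simp only at hij
    have key : ∀ t u, aff (.inl (i', c') : HypIndex n C m)
        (Function.update (Function.update (fun _ => u) j t) i (pairSign i j * t + (k : ℤ))) = 0 :=
      fun t u => H _ (by simp [aff, Function.update_of_ne hij.symm])
    have h0 := key 0 0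
    have h1 := key 1 0
    have h2 := key 0 1
    have hs := pairSign_ne_zero (i := i) (j := j)
    by_cases hi : i' = i
    · subst hi
      simp only [aff, Function.update_self] at h0 h1
      exact hs (by linear_combination h1 - h0)
    · by_cases hj : i' = j
      · subst hj
        simp only [aff, Function.update_self, Function.update_of_ne hi] at h0 h1
        have : (1 : ℂ) = 0 := by linear_combination h1 - h0
        simp at this
      · simp only [aff, Function.update_of_ne hi, Function.update_of_ne hj] at h0 h2
        have : (1 : ℂ) = 0 := by linear_combination h2 - h0
        simp at this
  · simp only at hij hij'
    have key : ∀ t (y : Fin n → ℂ), aff (.inr (⟨(i', j'), hij'⟩, k') : HypIndex n C m)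
        (Function.update (Function.update y j t) i (pairSign i j * t + (k : ℤ))) = 0 :=
      fun t u => H _ (by simp [aff, Function.update_of_ne hij.symm])
    have hs := pairSign_ne_zero (i := i) (j := j)
    have hs' := pairSign_ne_zero (i := i') (j := j')
    have h0 := key 0 0
    have h1 := key 1 0
    by_cases hi : i' = i
    · subst hi
      by_cases hj : j' = j
      · subst hj
        simp only [aff, Function.update_self, Function.update_of_ne hij.symm] at h0
        have : ((k : ℤ) : ℂ) = ((k' : ℤ) : ℂ) := by linear_combination h0
        have : k = k' := Subtype.ext (by exact_mod_cast this)
        rw [this]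
      · exfalso
        have h2 := key 0 (Function.update 0 j' 1)
        simp only [aff, Function.update_self, Function.update_of_ne hj,
          Function.update_of_ne hij'.symm] at h0 h2
        apply hs'
        simp only [Pi.zero_apply] at h0
        linear_combination h0 - h2
    · exfalso
      by_cases hj : i' = j
      · subst hj
        by_cases hj' : j' = i
        · subst hj'
          simp only [aff, Function.update_self, Function.update_of_ne hij'] at h0 h1
          have hp : pairSign i' j' * pairSign j' i' = -1 := by
            unfold pairSign
            rcases lt_or_gt_of_ne hij' with h | h <;> simp [h, h.not_gt]
          have : (2 : ℂ) = 0 := by linear_combination h1 - h0 + hp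
          simp at this
        · have h2 := key 0 (Function.update 0 j' 1)
          simp only [aff, Function.update_self, Function.update_of_ne hj',
            Function.update_of_ne hij'.symm, Function.update_of_ne hi] at h0 h2
          apply hs'
          simp only [Pi.zero_apply] at h0
          linear_combination h0 - h2
      · have h2 := key 0 (Function.update 0 i' 1)
        have e : Function.update (Function.update (Function.update (0 : Fin n → ℂ) i' 1) j 0) i
            (pairSign i j * 0 + (k : ℤ)) j' = Function.update (Function.update (0 : Fin n → ℂ) j 0)
            i (pairSign i j * 0 + (k : ℤ)) j' := by
          simp [Function.update_apply, hij'.symm]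
        simp only [aff] at h0 h2
        rw [e] at h2
        simp only [Function.update_self, Function.update_of_ne hj,
          Function.update_of_ne hi] at h0 h2
        have : (1 : ℂ) = 0 := by
          simp only [Pi.zero_apply] at h0
          linear_combination h2 - h0
        simp at this

end HypIndex

/-- `Z` plays the role of the homogenizing variable next to the variables `X (ι i)`: either a
further variable or the constant `1`. -/
structure IsConeVar {σ : Type*} [DecidableEq σ] {n : ℕ} (ι : Fin n → σ) (Z : MvPolynomial σ ℂ) :
    Prop where
  injective : Function.Injective ι
  indepOf : ∀ i, IndepOf (ι i) Z
  exists_point : ∀ x : Fin n → ℂ, ∃ y : σ → ℂ, (∀ i, y (ι i) = x i) ∧ eval y Z = 1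
  degLE : DegLE Z 1

namespace HypIndex

variable {n m : ℕ} {C : Finset ℂ}

/-- The leading variable of the defining form. -/
def lead (h : HypIndex n C m) : Fin n :=
  match h with
  | .inl (i, _) => i
  | .inr (p, _) => p.1.1

/-- The defining form is `X (ι h.lead) - h.rest`. -/
def rest (ι : Fin n → σ) (Z : MvPolynomial σ ℂ) (h : HypIndex n C m) : MvPolynomial σ ℂ :=
  match h with
  | .inl (_, c) => MvPolynomial.C (c : ℂ) * Z
  | .inr (p, k) => MvPolynomial.C (pairSign p.1.1 p.1.2) * X (ι p.1.2) +
      MvPolynomial.C ((k : ℤ) : ℂ) * Z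

/-- The linear form on coefficient vectors. -/
def weight (σ : Type*) (h : HypIndex n C m) : Fin n → MvPolynomial σ ℂ :=
  match h with
  | .inl (i, _) => Pi.single i 1
  | .inr (p, _) => Pi.single p.1.1 1 - Pi.single p.1.2 (MvPolynomial.C (pairSign p.1.1 p.1.2))

theorem indepOf_rest {σ : Type*} [DecidableEq σ] {ι : Fin n → σ} {Z : MvPolynomial σ ℂ}
    (hZ : IsConeVar ι Z) (h : HypIndex n C m) :
    IndepOf (ι h.lead) (h.rest ι Z) := by
  intro x a
  rcases h with ⟨i, c⟩ | ⟨⟨⟨i, j⟩, hij⟩, k⟩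
  · simp [rest, lead, hZ.indepOf i x a]
  · have : ι j ≠ ι i := fun h => hij (hZ.injective h).symm
    simp [rest, lead, hZ.indepOf i x a, this]

theorem eval_form {σ : Type*} {ι : Fin n → σ} {Z : MvPolynomial σ ℂ} {y : σ → ℂ} {x : Fin n → ℂ}
    (hy : ∀ i, y (ι i) = x i) (hz : eval y Z = 1)
    (h : HypIndex n C m) : eval y (X (ι h.lead) - h.rest ι Z) = h.aff x := by
  rcases h with ⟨i, c⟩ | ⟨⟨⟨i, j⟩, hij⟩, k⟩
  · simp [rest, lead, aff, hy, hz]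
  · simp [rest, lead, aff, hy, hz]; ring

theorem degLE_form {σ : Type*} [DecidableEq σ] {ι : Fin n → σ} {Z : MvPolynomial σ ℂ}
    (hZ : IsConeVar ι Z) (h : HypIndex n C m) :
    DegLE (X (ι h.lead) - h.rest ι Z) 1 := by
  refine (DegLE.X _ le_rfl).sub ?_
  rcases h with ⟨i, c⟩ | ⟨⟨⟨i, j⟩, hij⟩, k⟩
  · exact hZ.degLE.C_mul _
  · exact ((DegLE.X _ le_rfl).C_mul _).add (hZ.degLE.C_mul _)

end HypIndex

/-- Saito's criterion for the arrangement `x_i = c`, `x_i ± x_j = k`. -/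
theorem saito_hypIndex {σ : Type*} [DecidableEq σ] {n m : ℕ} {C : Finset ℂ} {ι : Fin n → σ}
    {Z : MvPolynomial σ ℂ} (hZ : IsConeVar ι Z)
    (θ : Fin n → Fin n → MvPolynomial σ ℂ) (d : Fin n → ℤ) (hθd : ∀ k i, DegLE (θ k i) (d k))
    (hθ : ∀ k (h : HypIndex n C m), X (ι h.lead) - h.rest ι Z ∣ ∑ i, h.weight σ i * θ k i)
    (hsum : ∑ k, d k ≤ n * C.card + n * (n - 1) * (2 * m + 1))
    (hdet : Matrix.det (Matrix.of θ) ≠ 0)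
    (v : Fin n → MvPolynomial σ ℂ)
    (hv : ∀ h : HypIndex n C m, X (ι h.lead) - h.rest ι Z ∣ ∑ i, h.weight σ i * v i) :
    ∃ a : Fin n → MvPolynomial σ ℂ, (∀ i, v i = ∑ k, a k * θ k i) ∧
      ∀ e, (∀ i, DegLE (v i) e) → ∀ k, DegLE (a k) (e - d k) := by
  have hprime := fun h : HypIndex n C m => prime_sub (h.indepOf_rest hZ)
  refine saito (fun h : HypIndex n C m => X (ι h.lead) - h.rest ι Z) (fun h => h.weight σ) ?_
    hprime ?_ ?_ θ d hθd hθ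
    (by rw [HypIndex.card]; exact hsum) hdet v hv
  · rintro (⟨i, c⟩ | ⟨⟨⟨i, j⟩, hij⟩, k⟩)
    · exact ⟨i, by simp [HypIndex.weight]⟩
    · exact ⟨i, by simp [HypIndex.weight, Pi.single_eq_of_ne hij]⟩
  · intro h h' hne hdvd
    apply hne
    apply HypIndex.eq_of_aff_imp
    intro x hx
    obtain ⟨y, hy, hz⟩ := hZ.exists_point x
    rw [← HypIndex.eval_form hy hz] at hx ⊢
    obtain ⟨r, hr⟩ := hdvd
    rw [hr, map_mul, hx, zero_mul]
  · intro h
    rcases DegLE.iff_totalDegree.1 (h.degLE_form hZ) with h0 | h1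
    · exact absurd h0 (hprime h).ne_zero
    · by_contra hne
      have h0 := MvPolynomial.totalDegree_eq_zero_iff_eq_C.1
        (show (X (ι h.lead) - h.rest ι Z).totalDegree = 0 by omega)
      have := (hprime h).not_isUnit
      rw [h0] at this
      refine this (IsUnit.map MvPolynomial.C (isUnit_iff_ne_zero.2 ?_))
      intro hc
      rw [hc, map_zero] at h0
      exact (hprime h).ne_zero h0

theorem HypIndex.sum_weight {σ : Type*} {n m : ℕ} {C : Finset ℂ}
    (v : Fin n → MvPolynomial σ ℂ) (h : HypIndex n C m) :
    ∑ i, h.weight σ i * v i = match h with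
      | .inl (i, _) => v i
      | .inr (p, _) => v p.1.1 - MvPolynomial.C (pairSign p.1.1 p.1.2) * v p.1.2 := by
  rcases h with ⟨i, c⟩ | ⟨⟨⟨i, j⟩, hij⟩, k⟩
  · simp [HypIndex.weight, Pi.single_apply]
  · simp [HypIndex.weight, Pi.single_apply, sub_mul, Finset.sum_sub_distrib]

/-- Invariance under permutations and sign changes of the variables. -/
structure IsWInvariant {n : ℕ} (p : MvPolynomial (Fin n) ℂ) : Prop where
  perm : ∀ (σ : Equiv.Perm (Fin n)) (x : Fin n → ℂ), eval (x ∘ σ) p = eval x p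
  flip : ∀ (i : Fin n) (x : Fin n → ℂ), eval (Function.update x i (-x i)) p = eval x p

/-- Vector fields on `ℂ^n` that are equivariant under permutations and sign changes of the
coordinates and tangent to the hyperplanes `x_i = c`, `c ∈ C`, and `x_i ± x_j = k`, `|k| ≤ m`. -/
structure EquivLog {n : ℕ} (C : Finset ℂ) (m : ℕ) (g : Fin n → MvPolynomial (Fin n) ℂ) :
    Prop where
  perm : ∀ (σ : Equiv.Perm (Fin n)) (x : Fin n → ℂ) i, eval (x ∘ σ) (g i) = eval x (g (σ i))
  flip_self : ∀ i (x : Fin n → ℂ), eval (Function.update x i (-x i)) (g i) = -eval x (g i)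
  flip_ne : ∀ i j, j ≠ i → ∀ x : Fin n → ℂ,
    eval (Function.update x i (-x i)) (g j) = eval x (g j)
  eq_zero : ∀ i (x : Fin n → ℂ), x i ∈ C → eval x (g i) = 0
  eq_of_sub : ∀ i j, i ≠ j → ∀ k : ℤ, |k| ≤ m → ∀ x : Fin n → ℂ, x i - x j = k →
    eval x (g i) = eval x (g j)

namespace IsWInvariant

variable {n : ℕ} {p q : MvPolynomial (Fin n) ℂ}

theorem C (a : ℂ) : IsWInvariant (C a : MvPolynomial (Fin n) ℂ) := ⟨by simp, by simp⟩

theorem sub (hp : IsWInvariant p) (hq : IsWInvariant q) : IsWInvariant (p - q) :=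
  ⟨fun σ x => by simp [hp.perm, hq.perm], fun i x => by simp [hp.flip, hq.flip]⟩

theorem mul (hp : IsWInvariant p) (hq : IsWInvariant q) : IsWInvariant (p * q) :=
  ⟨fun σ x => by simp [hp.perm, hq.perm], fun i x => by simp [hp.flip, hq.flip]⟩

theorem sum {ι : Type*} {s : Finset ι} {f : ι → MvPolynomial (Fin n) ℂ}
    (h : ∀ i ∈ s, IsWInvariant (f i)) : IsWInvariant (∑ i ∈ s, f i) :=
  ⟨fun σ x => by
    rw [map_sum, map_sum]; exact Finset.sum_congr rfl fun i hi => (h i hi).perm σ x,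
   fun j x => by
    rw [map_sum, map_sum]; exact Finset.sum_congr rfl fun i hi => (h i hi).flip j x⟩

end IsWInvariant

namespace EquivLog

variable {n m : ℕ} {C : Finset ℂ} {g g' : Fin n → MvPolynomial (Fin n) ℂ}

theorem mono {C' : Finset ℂ} (h : EquivLog C m g) (hC : C' ⊆ C) : EquivLog C' m g :=
  ⟨h.perm, h.flip_self, h.flip_ne, fun i x hx => h.eq_zero i x (hC hx), h.eq_of_sub⟩

theorem add_eq_zero (h : EquivLog C m g) {i j : Fin n} (hij : i ≠ j) {k : ℤ} (hk : |k| ≤ m)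
    {x : Fin n → ℂ} (hx : x i + x j = k) : eval x (g i) + eval x (g j) = 0 := by
  have := h.eq_of_sub i j hij k hk (Function.update x j (-x j)) (by
    rw [Function.update_self, Function.update_of_ne hij, ← hx]; ring)
  rw [h.flip_ne j i hij, h.flip_self] at this
  rw [this]; ring

/-- Linear combinations with invariant coefficients. -/
theorem sum {ι : Type*} {s : Finset ι} {a : ι → MvPolynomial (Fin n) ℂ}
    {φ : ι → Fin n → MvPolynomial (Fin n) ℂ} (ha : ∀ k ∈ s, IsWInvariant (a k))
    (hφ : ∀ k ∈ s, EquivLog C m (φ k)) : EquivLog C m (fun i => ∑ k ∈ s, a k * φ k i) where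
  perm σ x i := by
    simp only [map_sum, map_mul]
    exact Finset.sum_congr rfl fun k hk => by rw [(ha k hk).perm, (hφ k hk).perm]
  flip_self i x := by
    simp only [map_sum, map_mul, ← Finset.sum_neg_distrib]
    exact Finset.sum_congr rfl fun k hk => by rw [(ha k hk).flip, (hφ k hk).flip_self]; ring
  flip_ne i j hij x := by
    simp only [map_sum, map_mul]
    exact Finset.sum_congr rfl fun k hk => by rw [(ha k hk).flip, (hφ k hk).flip_ne i j hij]
  eq_zero i x hx := by
    simp only [map_sum, map_mul]
    exact Finset.sum_eq_zero fun k hk => by rw [(hφ k hk).eq_zero i x hx, mul_zero]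
  eq_of_sub i j hij l hl x hx := by
    simp only [map_sum, map_mul]
    exact Finset.sum_congr rfl fun k hk => by rw [(hφ k hk).eq_of_sub i j hij l hl x hx]

end EquivLog

theorem isConeVar_affine (n : ℕ) :
    IsConeVar (id : Fin n → Fin n) (1 : MvPolynomial (Fin n) ℂ) where
  injective := Function.injective_id
  indepOf i x a := by simp
  exists_point x := ⟨x, by simp⟩
  degLE := DegLE.one zero_le_one

theorem EquivLog.form_dvd {n m : ℕ} {C : Finset ℂ} {g : Fin n → MvPolynomial (Fin n) ℂ}
    (hg : EquivLog C m g) (h : HypIndex n C m) :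
    X (id h.lead) - h.rest id 1 ∣ ∑ i, h.weight (Fin n) i * g i := by
  rw [sub_dvd_iff_eval (h.indepOf_rest (isConeVar_affine n)), HypIndex.sum_weight]
  intro x hx
  rcases h with ⟨i, c⟩ | ⟨⟨⟨i, j⟩, hij⟩, k⟩
  · apply hg.eq_zero i x
    have : x i = c := by simpa [HypIndex.lead, HypIndex.rest] using hx
    rw [this]; exact c.2
  · have hk : |(k : ℤ)| ≤ m := abs_le.2 (Finset.mem_Icc.1 k.2)
    simp only [HypIndex.lead, HypIndex.rest, id, map_add, map_mul, eval_C, eval_X,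
      mul_one] at hx
    simp only at hij
    by_cases hlt : i < j
    · simp only [pairSign, hlt, if_true] at hx ⊢
      have := hg.eq_of_sub i j hij k hk x (by rw [hx]; ring)
      simp [this]
    · simp only [pairSign, hlt, if_false] at hx ⊢
      have := hg.add_eq_zero hij hk (x := x) (by rw [hx]; ring)
      simpa using this

/-- The degrees of a basis of equivariant logarithmic fields, where `2 κ + 1` is the number of
hyperplanes `x_i = c` for each `i`. -/
def basisDeg (n κ m : ℕ) (k : Fin n) : ℤ := 2 * κ + 1 + 2 * m * ((n : ℤ) - 1) + 2 * (k : ℕ)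

theorem sum_basisDeg (n κ m : ℕ) :
    ∑ k, basisDeg n κ m k = n * (2 * κ + 1) + n * (n - 1) * (2 * m + 1) := by
  have h : ∑ k : Fin n, (2 : ℤ) * ((k : ℕ) : ℤ) = n * (n - 1) := by
    rw [Fin.sum_univ_eq_sum_range (fun k => (2 : ℤ) * (k : ℤ)) n]
    induction n with
    | zero => simp
    | succ n ih => rw [Finset.sum_range_succ, ih]; push_cast; ring
  simp only [basisDeg]
  rw [Finset.sum_add_distrib, h]
  simp
  ring

/-- A basis of the logarithmic fields consisting of equivariant fields of the expected degrees. -/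
structure IsEquivBasis {n : ℕ} (C : Finset ℂ) (κ m : ℕ)
    (θ : Fin n → Fin n → MvPolynomial (Fin n) ℂ) : Prop where
  equivLog : ∀ k, EquivLog C m (θ k)
  degLE : ∀ k i, DegLE (θ k i) (basisDeg n κ m k)
  det_ne_zero : Matrix.det (Matrix.of θ) ≠ 0

theorem eq_zero_of_sum_eq_zero {R : Type*} [CommRing R] [IsDomain R] {n : ℕ}
    {θ : Fin n → Fin n → R} (h : Matrix.det (Matrix.of θ) ≠ 0) {a : Fin n → R}
    (ha : ∀ i, ∑ k, a k * θ k i = 0) : ∀ k, a k = 0 := by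
  by_contra! hne
  obtain ⟨k, hk⟩ := hne
  exact h (Matrix.exists_vecMul_eq_zero_iff.1 ⟨a, fun h0 => hk (by rw [h0]; rfl), by
    ext i; simpa [Matrix.vecMul, dotProduct] using ha i⟩)

theorem det_ne_zero_of_sum {R : Type*} [CommRing R] [IsDomain R] {n : ℕ}
    {θ : Fin n → Fin n → R} (h : ∀ a : Fin n → R, (∀ i, ∑ k, a k * θ k i = 0) → ∀ k, a k = 0) :
    Matrix.det (Matrix.of θ) ≠ 0 := by
  intro h0
  obtain ⟨a, ha, hz⟩ := Matrix.exists_vecMul_eq_zero_iff.2 h0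
  exact ha (funext (h a fun i => by
    simpa [Matrix.vecMul, dotProduct] using congrFun hz i))

theorem IsEquivBasis.exists_coeff {n κ m : ℕ} {C : Finset ℂ}
    {θ : Fin n → Fin n → MvPolynomial (Fin n) ℂ} (hθ : IsEquivBasis C κ m θ)
    (hC : C.card = 2 * κ + 1) {v : Fin n → MvPolynomial (Fin n) ℂ} (hv : EquivLog C m v) :
    ∃ a : Fin n → MvPolynomial (Fin n) ℂ, (∀ i, v i = ∑ k, a k * θ k i) ∧
      (∀ k, IsWInvariant (a k)) ∧
      ∀ e, (∀ i, DegLE (v i) e) → ∀ k, DegLE (a k) (e - basisDeg n κ m k) := by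
  obtain ⟨a, ha, hd⟩ := saito_hypIndex (C := C) (m := m) (isConeVar_affine n) θ _ hθ.degLE
    (fun k h => (hθ.equivLog k).form_dvd h) (by rw [sum_basisDeg, hC]; push_cast; rfl)
    hθ.det_ne_zero v fun h => hv.form_dvd h
  refine ⟨a, ha, ?_, hd⟩
  have hpe : ∀ x i, eval x (v i) = ∑ k, eval x (a k) * eval x (θ k i) := fun x i => by
    rw [ha i]; simp
  have key : ∀ (T : MvPolynomial (Fin n) ℂ →ₐ[ℂ] MvPolynomial (Fin n) ℂ),
      (∀ i, ∑ k, (T (a k) - a k) * θ k i = 0) → ∀ x k, eval x (T (a k)) = eval x (a k) := by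
    intro T hT x k
    rw [sub_eq_zero.1 (eq_zero_of_sum_eq_zero hθ.det_ne_zero hT k)]
  have hperm : ∀ (σ : Equiv.Perm (Fin n)) x k, eval (x ∘ σ) (a k) = eval x (a k) := by
    intro σ x k
    rw [← key (rename σ) _ x k, eval_rename]
    intro i
    apply MvPolynomial.funext
    intro y
    have h1 := hpe (y ∘ σ) (σ.symm i)
    have h2 := hpe y i
    rw [hv.perm, σ.apply_symm_apply, h2] at h1
    simp only [(hθ.equivLog _).perm, σ.apply_symm_apply] at h1
    simp only [map_sum, map_mul, map_sub, eval_rename, sub_mul, Finset.sum_sub_distrib, map_zero]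
    rw [h1, sub_self]
  have hflip : ∀ (i : Fin n) x k, eval (Function.update x i (-x i)) (a k) = eval x (a k) := by
    intro i x k
    have := key (substVar i (-X i)) ?_ x k
    · rwa [eval_substVar, map_neg, eval_X] at this
    intro j
    apply MvPolynomial.funext
    intro y
    have h1 := hpe (Function.update y i (-y i)) j
    have h2 := hpe y j
    simp only [map_sum, map_mul, map_sub, eval_substVar, map_neg, eval_X, sub_mul,
      Finset.sum_sub_distrib, map_zero]
    by_cases hj : j = i
    · subst hj
      simp only [hv.flip_self, (hθ.equivLog _).flip_self, mul_neg, Finset.sum_neg_distrib,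
        neg_inj] at h1
      rw [← h1, ← h2, sub_self]
    · rw [hv.flip_ne i j hj] at h1
      simp only [(hθ.equivLog _).flip_ne i j hj] at h1
      rw [← h1, ← h2, sub_self]
  exact fun k => ⟨fun σ x => hperm σ x k, fun i x => hflip i x k⟩

section Lift

variable {n : ℕ}

theorem Fin.exists_perm_succAbove (j : Fin (n + 1)) {f : Fin n → Fin (n + 1)}
    (hf : Function.Injective f) (hj : ∀ i, f i ≠ j) :
    ∃ τ : Equiv.Perm (Fin n), f = j.succAbove ∘ τ := by
  choose t ht using fun i => Fin.exists_succAbove_eq (hj i)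
  have hinj : Function.Injective t := fun a b hab => hf (by rw [← ht, ← ht, hab])
  exact ⟨Equiv.ofBijective t (Finite.injective_iff_bijective.1 hinj), funext fun i => (ht i).symm⟩

/-- Restriction to the hyperplane on which the last coordinate is `c`. -/
def restrictLast (c : ℂ) : MvPolynomial (Fin (n + 1)) ℂ →ₐ[ℂ] MvPolynomial (Fin n) ℂ :=
  aeval (Fin.snoc (α := fun _ => MvPolynomial (Fin n) ℂ) X (C c))

theorem eval_restrictLast (c : ℂ) (p : MvPolynomial (Fin (n + 1)) ℂ) (x : Fin n → ℂ) :
    eval x (restrictLast c p) = eval (Fin.snoc (α := fun _ => ℂ) x c) p := by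
  have : (aeval x).comp (restrictLast c) =
      aeval (R := ℂ) (Fin.snoc (α := fun _ => ℂ) x c) := by
    apply MvPolynomial.algHom_ext
    intro j
    refine Fin.lastCases ?_ (fun i => ?_) j <;> simp [restrictLast]
  simpa [MvPolynomial.coe_aeval_eq_eval] using DFunLike.congr_fun this p

theorem DegLE.restrictLast {c : ℂ} {p : MvPolynomial (Fin (n + 1)) ℂ} {e : ℤ} (hp : DegLE p e) :
    DegLE (restrictLast c p) e := by
  refine hp.aeval fun i => ?_
  refine Fin.lastCases ?_ (fun i => ?_) i
  · simpa using DegLE.C c zero_le_one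
  · simpa using DegLE.X i le_rfl

theorem Function.update_comp_succAbove_self {α : Type*} (x : Fin (n + 1) → α) (j : Fin (n + 1))
    (a : α) : Function.update x j a ∘ j.succAbove = x ∘ j.succAbove := by
  ext l; simp [Fin.succAbove_ne]

theorem Function.update_comp_succAbove {α : Type*} (x : Fin (n + 1) → α) (j : Fin (n + 1))
    (l : Fin n) (a : α) :
    Function.update x (j.succAbove l) a ∘ j.succAbove =
      Function.update (x ∘ j.succAbove) l a := by
  ext i
  by_cases h : i = l
  · subst h; simp
  · simp [h]

theorem exists_lift_partial {b : MvPolynomial (Fin n) ℂ} (hb : IsWInvariant b) {e : ℤ}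
    (hd : DegLE b e) (c : ℂ) (J : Finset (Fin (n + 1))) :
    ∃ A : MvPolynomial (Fin (n + 1)) ℂ, DegLE A e ∧
      (∀ i x, eval (Function.update x i (-x i)) A = eval x A) ∧
      ∀ j ∈ J, ∀ x : Fin (n + 1) → ℂ, x j = c → eval x A = eval (x ∘ j.succAbove) b := by
  classical
  induction J using Finset.induction_on with
  | empty => exact ⟨0, DegLE.zero, by simp, by simp⟩
  | insert j J hj ih =>
    obtain ⟨A, hA, hflip, hres⟩ := ih
    refine ⟨A + (rename j.succAbove b - substVar j (C c) A),
      hA.add ((hd.rename _).sub (hA.aeval fun i => ?_)), fun i x => ?_, fun i hi x hx => ?_⟩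
    · by_cases h : i = j
      · subst h; simpa using DegLE.C c zero_le_one
      · simpa [h] using DegLE.X i le_rfl
    · simp only [map_add, map_sub, eval_rename, eval_substVar, eval_C, hflip]
      by_cases h : i = j
      · subst h
        rw [Function.update_comp_succAbove_self, Function.update_idem]
      · obtain ⟨l, rfl⟩ := Fin.exists_succAbove_eq h
        rw [Function.update_comp_succAbove, Function.update_comm (Fin.succAbove_ne j l)]
        have h1 := hb.flip l (x ∘ j.succAbove)
        have h2 := hflip (j.succAbove l) (Function.update x j c)
        simp only [Function.comp_apply] at h1
        rw [Function.update_of_ne (Fin.succAbove_ne j l)] at h2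
        rw [h1, h2]
    · simp only [map_add, map_sub, eval_rename, eval_substVar, eval_C]
      by_cases h : i = j
      · subst h
        rw [← hx, Function.update_eq_self]; ring
      · have hiJ : i ∈ J := (Finset.mem_insert.1 hi).resolve_left h
        rw [hres i hiJ x hx, hres i hiJ (Function.update x j c) (by simp [h, hx])]
        obtain ⟨τ, hτ⟩ := Fin.exists_perm_succAbove j
          (f := Equiv.swap i j ∘ i.succAbove)
          ((Equiv.injective _).comp Fin.succAbove_right_injective) (fun l hl => by
            have : i.succAbove l = i := by
              simpa using congrArg (Equiv.swap i j) hl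
            exact Fin.succAbove_ne _ _ this)
        have : Function.update x j c ∘ i.succAbove = (x ∘ j.succAbove) ∘ τ := by
          rw [Function.comp_assoc, ← hτ]
          ext l
          simp only [Function.comp_apply]
          by_cases hl : i.succAbove l = j
          · rw [hl, Equiv.swap_apply_right, Function.update_self, hx]
          · rw [Function.update_of_ne hl, Equiv.swap_apply_of_ne_of_ne (Fin.succAbove_ne _ _) hl]
        rw [this, hb.perm]; ring

/-- Invariant polynomials lift from the hyperplane `x_n = c` without raising the degree. -/
theorem exists_lift {b : MvPolynomial (Fin n) ℂ} (hb : IsWInvariant b) {e : ℤ}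
    (hd : DegLE b e) (c : ℂ) :
    ∃ a : MvPolynomial (Fin (n + 1)) ℂ, IsWInvariant a ∧ DegLE a e ∧ restrictLast c a = b := by
  obtain ⟨A, hA, hflip, hres⟩ := exists_lift_partial hb hd c Finset.univ
  have hf : ((Nat.factorial (n + 1) : ℕ) : ℂ) ≠ 0 := by exact_mod_cast Nat.factorial_ne_zero _
  have heval : ∀ x, eval x (C ((Nat.factorial (n + 1) : ℕ) : ℂ)⁻¹ *
      ∑ σ : Equiv.Perm (Fin (n + 1)), rename σ A) =
      ((Nat.factorial (n + 1) : ℕ) : ℂ)⁻¹ * ∑ σ : Equiv.Perm (Fin (n + 1)), eval (x ∘ σ) A :=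
    fun x => by simp [eval_rename]
  refine ⟨C ((Nat.factorial (n + 1) : ℕ) : ℂ)⁻¹ * ∑ σ : Equiv.Perm (Fin (n + 1)), rename σ A,
    ⟨fun τ x => ?_, fun i x => ?_⟩, (DegLE.sum fun σ _ => hA.rename _).C_mul _, ?_⟩
  · rw [heval, heval]
    congr 1
    exact Fintype.sum_equiv (Equiv.mulLeft τ) _ _ fun σ => by simp [Function.comp_assoc]
  · rw [heval, heval]
    congr 1
    refine Finset.sum_congr rfl fun σ _ => ?_
    rw [← hflip (σ.symm i) (x ∘ σ)]
    congr 2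
    ext l
    by_cases h : l = σ.symm i
    · subst h; simp
    · have : σ l ≠ i := fun h' => h (by rw [← h', σ.symm_apply_apply])
      simp [h, this]
  · apply MvPolynomial.funext
    intro x
    rw [eval_restrictLast, heval]
    set y : Fin (n + 1) → ℂ := Fin.snoc (α := fun _ => ℂ) x c with hy
    have : ∀ σ : Equiv.Perm (Fin (n + 1)), eval (y ∘ σ) A = eval x b := by
      intro σ
      set j := σ.symm (Fin.last n) with hj
      rw [hres j (Finset.mem_univ _) (y ∘ σ) (by simp [hj, hy])]
      obtain ⟨τ, hτ⟩ := Fin.exists_perm_succAbove (Fin.last n) (f := σ ∘ j.succAbove)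
        (σ.injective.comp Fin.succAbove_right_injective) (fun l hl => by
          have : j.succAbove l = j := by
            rw [hj]; apply σ.injective; simpa [hj] using hl
          exact Fin.succAbove_ne _ _ this)
      have h2 : (y ∘ σ) ∘ j.succAbove = x ∘ τ := by
        rw [Function.comp_assoc, hτ]
        ext l
        simp [hy]
      rw [h2, hb.perm]
    rw [Finset.sum_congr rfl fun σ _ => this σ]
    simp [Fintype.card_perm]
    field_simp

end Lift

/-- The coefficients along the hyperplane `x_n = c` of the restriction of a field. -/
def restrictField {n : ℕ} (c : ℂ) (g : Fin (n + 1) → MvPolynomial (Fin (n + 1)) ℂ) :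
    Fin n → MvPolynomial (Fin n) ℂ := fun i => restrictLast c (g i.castSucc)

theorem Fin.snoc_update_castSucc {n : ℕ} (x : Fin n → ℂ) (c a : ℂ) (i : Fin n) :
    Fin.snoc (α := fun _ => ℂ) (Function.update x i a) c =
      Function.update (Fin.snoc (α := fun _ => ℂ) x c) i.castSucc a := by
  ext l
  refine Fin.lastCases ?_ (fun j => ?_) l
  · rw [Function.update_of_ne (Fin.castSucc_lt_last i).ne']; simp
  · by_cases h : j = i
    · subst h; simp
    · have : j.castSucc ≠ i.castSucc := fun h' => h (Fin.castSucc_injective n h')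
      simp [h, this]

/-- Tangency is inherited by restrictions: the hyperplanes `x_i = c'` downstairs are traces of
hyperplanes upstairs. -/
theorem EquivLog.restrict {n m : ℕ} {C C'' : Finset ℂ} {c : ℂ} (hc : c ∈ C)
    (hC'' : ∀ c' ∈ C'', c' ∈ C ∨ (∃ k : ℤ, |k| ≤ m ∧ c' - c = k) ∨ ∃ k : ℤ, |k| ≤ m ∧ c' + c = k)
    {g : Fin (n + 1) → MvPolynomial (Fin (n + 1)) ℂ} (hg : EquivLog C m g) :
    EquivLog C'' m (restrictField c g) where
  perm τ x i := by
    simp only [restrictField, eval_restrictLast]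
    have := hg.perm (finSuccEquivLast.symm.permCongr (Equiv.optionCongr τ))
      (Fin.snoc (α := fun _ => ℂ) x c) i.castSucc
    simp only [Equiv.permCongr_apply, Equiv.symm_symm, finSuccEquivLast_castSucc,
      Equiv.optionCongr_apply, Option.map_some, finSuccEquivLast_symm_some] at this
    rw [← this]
    congr 2
    ext l
    refine Fin.lastCases ?_ (fun j => ?_) l <;> simp [Equiv.permCongr_apply]
  flip_self i x := by
    simp only [restrictField, eval_restrictLast, Fin.snoc_update_castSucc]
    simpa using hg.flip_self i.castSucc (Fin.snoc (α := fun _ => ℂ) x c)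
  flip_ne i j hij x := by
    simp only [restrictField, eval_restrictLast, Fin.snoc_update_castSucc]
    simpa using hg.flip_ne i.castSucc j.castSucc
      (fun h => hij (Fin.castSucc_injective n h)) (Fin.snoc (α := fun _ => ℂ) x c)
  eq_zero i x hx := by
    simp only [restrictField, eval_restrictLast]
    have hne : i.castSucc ≠ Fin.last n := (Fin.castSucc_lt_last i).ne
    have h0 : eval (Fin.snoc (α := fun _ => ℂ) x c) (g (Fin.last n)) = 0 :=
      hg.eq_zero _ _ (by simpa using hc)
    rcases hC'' _ hx with h | ⟨k, hk, h⟩ | ⟨k, hk, h⟩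
    · exact hg.eq_zero _ _ (by simpa using h)
    · rw [hg.eq_of_sub _ _ hne k hk _ (by simpa using h), h0]
    · have := hg.add_eq_zero hne hk (x := Fin.snoc (α := fun _ => ℂ) x c) (by simpa using h)
      rwa [h0, add_zero] at this
  eq_of_sub i j hij k hk x hx := by
    simp only [restrictField, eval_restrictLast]
    exact hg.eq_of_sub _ _ (fun h => hij (Fin.castSucc_injective n h)) k hk _ (by simpa using hx)

section LinearProduct

variable {n : ℕ}

theorem indepOf_C (i : Fin n) (a : ℂ) : IndepOf i (C a : MvPolynomial (Fin n) ℂ) := by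
  intro x b; simp

theorem totalDegree_X_sub_C (i : Fin n) (a : ℂ) :
    (X i - C a : MvPolynomial (Fin n) ℂ).totalDegree = 1 := by
  have hp := prime_sub (indepOf_C i a)
  have h : DegLE (X i - C a : MvPolynomial (Fin n) ℂ) 1 :=
    (DegLE.X i le_rfl).sub (DegLE.C a zero_le_one)
  rcases DegLE.iff_totalDegree.1 h with h0 | h1
  · exact absurd h0 hp.ne_zero
  · by_contra hne
    have h0 := MvPolynomial.totalDegree_eq_zero_iff_eq_C.1
      (show (X i - C a : MvPolynomial (Fin n) ℂ).totalDegree = 0 by omega)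
    have h2 := congrArg (eval fun _ => a) h0
    have h3 := congrArg (eval fun _ => a + 1) h0
    simp only [map_sub, eval_X, eval_C, sub_self] at h2 h3
    rw [← h2] at h3
    simp at h3

/-- The product of the linear forms `X i - a`, `(i, a) ∈ T`. -/
def linProd (T : Finset (Fin n × ℂ)) : MvPolynomial (Fin n) ℂ := ∏ t ∈ T, (X t.1 - C t.2)

theorem linProd_ne_zero (T : Finset (Fin n × ℂ)) : linProd T ≠ 0 :=
  Finset.prod_ne_zero_iff.2 fun t _ => sub_ne_zero_of_indepOf (indepOf_C t.1 t.2)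

theorem totalDegree_linProd (T : Finset (Fin n × ℂ)) : (linProd T).totalDegree = T.card := by
  have h := totalDegree_prod_of_ne_zero (s := T)
    (f := fun t : Fin n × ℂ => (X t.1 - C t.2 : MvPolynomial (Fin n) ℂ)) fun t _ =>
    sub_ne_zero_of_indepOf (indepOf_C t.1 t.2)
  simp only [totalDegree_X_sub_C, Finset.sum_const, smul_eq_mul, mul_one] at h
  exact h

theorem linProd_dvd {T : Finset (Fin n × ℂ)} {p : MvPolynomial (Fin n) ℂ}
    (h : ∀ t ∈ T, ∀ x : Fin n → ℂ, x t.1 = t.2 → eval x p = 0) : linProd T ∣ p := by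
  refine Finset.prod_dvd_of_prime (fun t _ => prime_sub (indepOf_C _ _)) ?_ fun t ht => ?_
  · rintro ⟨i, a⟩ - ⟨j, b⟩ - hne hd
    rw [sub_dvd_iff_eval (indepOf_C _ _)] at hd
    by_cases hij : j = i
    · subst hij
      have := hd (fun _ => a) (by simp)
      simp only [map_sub, eval_X, eval_C, sub_eq_zero] at this
      exact hne (by rw [this])
    · have := hd (Function.update (fun _ => b + 1) i a) (by simp)
      simp [hij] at this
  · rw [sub_dvd_iff_eval (indepOf_C _ _)]
    intro x hx
    exact h t ht x (by simpa using hx)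

theorem eq_zero_of_linProd {T : Finset (Fin n × ℂ)} {p : MvPolynomial (Fin n) ℂ}
    (h : ∀ t ∈ T, ∀ x : Fin n → ℂ, x t.1 = t.2 → eval x p = 0) {e : ℤ} (hp : DegLE p e)
    (he : e < T.card) : p = 0 := by
  obtain ⟨r, rfl⟩ := linProd_dvd h
  rw [(hp.of_mul (linProd_ne_zero T)).eq_zero (by rw [totalDegree_linProd]; omega), mul_zero]

theorem eval_linProd_pair {c : ℂ} (hc : c ≠ 0) (x : Fin n → ℂ) :
    eval x (linProd (Finset.univ ×ˢ {c, -c})) = ∏ j, (x j ^ 2 - c ^ 2) := by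
  have hne : c ≠ -c := fun h => hc (self_eq_neg.1 h)
  rw [linProd, map_prod, Finset.prod_product]
  refine Finset.prod_congr rfl fun j _ => ?_
  rw [Finset.prod_pair hne]
  simp
  ring

theorem card_univ_product_pair {c : ℂ} (hc : c ≠ 0) :
    ((Finset.univ : Finset (Fin n)) ×ˢ ({c, -c} : Finset ℂ)).card = n * 2 := by
  have hne : c ≠ -c := fun h => hc (self_eq_neg.1 h)
  rw [Finset.card_product, Finset.card_pair hne]
  simp

theorem isWInvariant_linProd_pair {c : ℂ} (hc : c ≠ 0) :
    IsWInvariant (linProd ((Finset.univ : Finset (Fin n)) ×ˢ {c, -c})) where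
  perm σ x := by
    rw [eval_linProd_pair hc, eval_linProd_pair hc]
    exact Equiv.prod_comp σ fun j => (x j ^ 2 - c ^ 2)
  flip i x := by
    rw [eval_linProd_pair hc, eval_linProd_pair hc]
    refine Finset.prod_congr rfl fun j _ => ?_
    by_cases h : j = i
    · subst h; simp
    · simp [h]

end LinearProduct

/-- An equivariant field divided by an invariant polynomial. -/
theorem EquivLog.of_mul {n m : ℕ} {C C' : Finset ℂ} {P : MvPolynomial (Fin n) ℂ}
    {g : Fin n → MvPolynomial (Fin n) ℂ} (hP0 : P ≠ 0) (hP : IsWInvariant P)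
    (hg : EquivLog C m fun i => P * g i) (hC : C' ⊆ C)
    (hPC : ∀ i, ∀ c ∈ C', ∃ x : Fin n → ℂ, x i = c ∧ eval x P ≠ 0)
    (hPk : ∀ i j, i ≠ j → ∀ k : ℤ, ∃ x : Fin n → ℂ, x i - x j = k ∧ eval x P ≠ 0) :
    EquivLog C' m g where
  perm σ x i := by
    rw [← eval_rename]
    congr 1
    apply mul_left_cancel₀ hP0
    apply MvPolynomial.funext
    intro y
    have := hg.perm σ y i
    simpa [hP.perm, eval_rename] using this
  flip_self i x := by
    have : substVar i (-X i) (g i) = -g i := by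
      apply mul_left_cancel₀ hP0
      apply MvPolynomial.funext
      intro y
      have := hg.flip_self i y
      simpa [hP.flip, eval_substVar] using this
    simpa [eval_substVar] using congrArg (eval x) this
  flip_ne i j hij x := by
    have : substVar i (-X i) (g j) = g j := by
      apply mul_left_cancel₀ hP0
      apply MvPolynomial.funext
      intro y
      have := hg.flip_ne i j hij y
      simpa [hP.flip, eval_substVar] using this
    simpa [eval_substVar] using congrArg (eval x) this
  eq_zero i x hx := by
    have hi := indepOf_C i (x i)
    have hd : X i - MvPolynomial.C (x i) ∣ P * g i := by
      rw [sub_dvd_iff_eval hi]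
      intro y hy
      exact hg.eq_zero i y (by rw [hy, eval_C]; exact hC hx)
    rcases (prime_sub hi).dvd_or_dvd hd with h | h
    · obtain ⟨y, hy, hne⟩ := hPC i _ hx
      exact absurd ((sub_dvd_iff_eval hi _).1 h y (by simpa using hy)) hne
    · exact (sub_dvd_iff_eval hi _).1 h x (by simp)
  eq_of_sub i j hij k hk x hx := by
    have hi : IndepOf i (X j + MvPolynomial.C (k : ℂ)) := by
      intro y a; simp [hij.symm]
    have hd : X i - (X j + MvPolynomial.C (k : ℂ)) ∣ P * (g i - g j) := by
      rw [sub_dvd_iff_eval hi]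
      intro y hy
      have := hg.eq_of_sub i j hij k hk y (by rw [hy]; simp)
      simp only [map_mul] at this
      rw [map_mul, map_sub, mul_sub, this, sub_self]
    rcases (prime_sub hi).dvd_or_dvd hd with h | h
    · obtain ⟨y, hy, hne⟩ := hPk i j hij k
      exact absurd ((sub_dvd_iff_eval hi _).1 h y (by simp [← hy])) hne
    · have := (sub_dvd_iff_eval hi _).1 h x (by simp [← hx])
      simpa [sub_eq_zero] using this

/-- A field whose restriction to `x_n = c` vanishes is divisible by `∏ (x_j² - c²)`, with a
quotient which is logarithmic for the arrangement without the hyperplanes `x_j = ± c`. -/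
theorem EquivLog.exists_eq_mul {n m : ℕ} {C C' : Finset ℂ} {c : ℂ} (hc : c ∈ C) (hc0 : c ≠ 0)
    {g : Fin (n + 1) → MvPolynomial (Fin (n + 1)) ℂ} (hg : EquivLog C m g)
    (hr : restrictField c g = 0) (hC : C' ⊆ C) (hC' : ∀ c' ∈ C', c' ^ 2 ≠ c ^ 2) :
    ∃ θ : Fin (n + 1) → MvPolynomial (Fin (n + 1)) ℂ,
      (∀ i, g i = linProd (Finset.univ ×ˢ {c, -c}) * θ i) ∧ EquivLog C' m θ ∧
      ∀ e, (∀ i, DegLE (g i) e) → ∀ i, DegLE (θ i) (e - 2 * (n + 1)) := by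
  classical
  have h1 : ∀ x : Fin (n + 1) → ℂ, x (Fin.last n) = c → ∀ i, eval x (g i) = 0 := by
    intro x hx i
    refine Fin.lastCases ?_ (fun i => ?_) i
    · exact hg.eq_zero _ _ (by rwa [hx])
    · have := congrArg (eval (Fin.init x)) (congrFun hr i)
      simpa [restrictField, eval_restrictLast, ← hx] using this
  have h2 : ∀ j (x : Fin (n + 1) → ℂ), x j = c → ∀ i, eval x (g i) = 0 := by
    intro j x hx i
    have := hg.perm (Equiv.swap j (Fin.last n)) x (Equiv.swap j (Fin.last n) i)
    rw [Equiv.swap_apply_self, h1 _ (by simp [hx])] at this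
    exact this.symm
  have h3 : ∀ j (x : Fin (n + 1) → ℂ), x j = -c → ∀ i, eval x (g i) = 0 := by
    intro j x hx i
    have h := h2 j (Function.update x j (-x j)) (by simp [hx]) i
    by_cases hij : i = j
    · subst hij
      rw [hg.flip_self] at h
      exact neg_eq_zero.1 h
    · rwa [hg.flip_ne j i hij] at h
  have hdvd : ∀ i, linProd (Finset.univ ×ˢ {c, -c}) ∣ g i := by
    intro i
    refine linProd_dvd fun t ht x hx => ?_
    simp only [Finset.mem_product, Finset.mem_univ, true_and, Finset.mem_insert,
      Finset.mem_singleton] at ht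
    rcases ht with ht | ht
    · exact h2 t.1 x (by rw [hx, ht]) i
    · exact h3 t.1 x (by rw [hx, ht]) i
  choose θ hθ using hdvd
  refine ⟨θ, hθ, ?_, fun e he i => ?_⟩
  · have hg' : EquivLog C m fun i => linProd (Finset.univ ×ˢ {c, -c}) * θ i := by
      rwa [← funext hθ]
    refine EquivLog.of_mul (linProd_ne_zero _) (isWInvariant_linProd_pair hc0) hg' hC ?_ ?_
    · intro i c' hc'
      refine ⟨fun _ => c', rfl, ?_⟩
      rw [eval_linProd_pair hc0]
      exact Finset.prod_ne_zero_iff.2 fun j _ => sub_ne_zero.2 (hC' c' hc')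
    · intro i j hij k
      obtain ⟨t, ht⟩ := Infinite.exists_notMem_finset ({c, -c, c - k, -c - k} : Finset ℂ)
      simp only [Finset.mem_insert, Finset.mem_singleton, not_or] at ht
      refine ⟨Function.update (fun _ => t) i (t + k), by simp [hij.symm], ?_⟩
      rw [eval_linProd_pair hc0]
      refine Finset.prod_ne_zero_iff.2 fun l _ => sub_ne_zero.2 fun h => ?_
      by_cases hl : l = i
      · subst hl
        rw [Function.update_self] at h
        rcases sq_eq_sq_iff_eq_or_eq_neg.1 h with h | h
        · exact ht.2.2.1 (eq_sub_of_add_eq h)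
        · exact ht.2.2.2 (eq_sub_of_add_eq h)
      · rw [Function.update_of_ne hl] at h
        rcases sq_eq_sq_iff_eq_or_eq_neg.1 h with h | h
        · exact ht.1 h
        · exact ht.2.1 h
  · have := he i
    rw [hθ i] at this
    refine (this.of_mul (linProd_ne_zero _)).mono ?_
    rw [totalDegree_linProd, card_univ_product_pair hc0]
    push_cast
    omega

/-- The half-odd numbers `± 1/2, …, ± (2 m - 1) / 2`. -/
def halfOdds (m : ℕ) : Finset ℂ := (Finset.Ico (-(m : ℤ)) m).image fun j : ℤ => (j : ℂ) + 1 / 2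

/-- The integers of absolute value at most `m`. -/
def intsUpTo (m : ℕ) : Finset ℂ := (Finset.Icc (-(m : ℤ)) m).image fun j : ℤ => (j : ℂ)

/-- The values `c` for which `x_i = c` belongs to the extended Catalan arrangement. -/
def catalanValues (m₁ m₂ : ℕ) : Finset ℂ := intsUpTo m₁ ∪ halfOdds m₂

theorem mem_intsUpTo {m : ℕ} {c : ℂ} : c ∈ intsUpTo m ↔ ∃ j : ℤ, |j| ≤ m ∧ c = j := by
  simp [intsUpTo, abs_le, eq_comm]

theorem mem_halfOdds {m : ℕ} {c : ℂ} :
    c ∈ halfOdds m ↔ ∃ j : ℤ, (-(m : ℤ) ≤ j ∧ j < m) ∧ c = j + 1 / 2 := by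
  simp [halfOdds, eq_comm]

theorem card_intsUpTo (m : ℕ) : (intsUpTo m).card = 2 * m + 1 := by
  rw [intsUpTo, Finset.card_image_of_injective _ Int.cast_injective, Int.card_Icc]
  omega

theorem card_halfOdds (m : ℕ) : (halfOdds m).card = 2 * m := by
  rw [halfOdds, Finset.card_image_of_injective _ fun a b h => by simpa using h, Int.card_Ico]
  omega

theorem intCast_ne_intCast_add_half (i j : ℤ) : (i : ℂ) ≠ (j : ℂ) + 1 / 2 := by
  intro h
  have h2 : ((2 * i : ℤ) : ℂ) = ((2 * j + 1 : ℤ) : ℂ) := by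
    push_cast
    rw [h]; ring
  have : 2 * i = 2 * j + 1 := by exact_mod_cast h2
  omega

theorem card_catalanValues (m₁ m₂ : ℕ) : (catalanValues m₁ m₂).card = 2 * (m₁ + m₂) + 1 := by
  rw [catalanValues, Finset.card_union_of_disjoint, card_intsUpTo, card_halfOdds]
  · ring
  · rw [Finset.disjoint_left]
    intro c hc hc'
    obtain ⟨i, -, rfl⟩ := mem_intsUpTo.1 hc
    obtain ⟨j, -, h⟩ := mem_halfOdds.1 hc'
    exact intCast_ne_intCast_add_half i j h

theorem mem_catalanValues {m₁ m₂ : ℕ} {c : ℂ} : c ∈ catalanValues m₁ m₂ ↔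
    (∃ j : ℤ, |j| ≤ m₁ ∧ c = j) ∨ ∃ j : ℤ, (-(m₂ : ℤ) ≤ j ∧ j < m₂) ∧ c = j + 1 / 2 := by
  rw [catalanValues, Finset.mem_union, mem_intsUpTo, mem_halfOdds]

theorem catalanValues_mono {a b c d : ℕ} (h₁ : a ≤ c) (h₂ : b ≤ d) :
    catalanValues a b ⊆ catalanValues c d := by
  intro x hx
  rw [mem_catalanValues] at hx ⊢
  rcases hx with ⟨j, hj, rfl⟩ | ⟨j, hj, rfl⟩
  · exact Or.inl ⟨j, hj.trans (by exact_mod_cast h₁), rfl⟩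
  · exact Or.inr ⟨j, by omega, rfl⟩

theorem half_mem_catalanValues (m₁ k : ℕ) : (k : ℂ) + 1 / 2 ∈ catalanValues m₁ (k + 1) :=
  mem_catalanValues.2 (Or.inr ⟨k, by push_cast; omega, by simp⟩)

theorem int_mem_catalanValues (k m₂ : ℕ) : (k : ℂ) + 1 ∈ catalanValues (k + 1) m₂ :=
  mem_catalanValues.2 (Or.inl ⟨k + 1, by
    rw [abs_of_nonneg (by positivity)]; push_cast; exact le_rfl, by push_cast; rfl⟩)

theorem natCast_add_half_ne_zero (k : ℕ) : (k : ℂ) + 1 / 2 ≠ 0 := by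
  have := intCast_ne_intCast_add_half 0 k
  simpa using this.symm

theorem sq_ne_sq_half {m₁ k : ℕ} : ∀ c ∈ catalanValues m₁ k, c ^ 2 ≠ ((k : ℂ) + 1 / 2) ^ 2 := by
  intro c hc h
  rw [mem_catalanValues] at hc
  rcases sq_eq_sq_iff_eq_or_eq_neg.1 h with h | h <;> subst h <;>
    rcases hc with ⟨j, hj, h⟩ | ⟨j, hj, h⟩
  · exact intCast_ne_intCast_add_half j k (by rw [← h]; simp)
  · have : ((k : ℤ) : ℂ) = (j : ℂ) := by push_cast; linear_combination h
    have : (k : ℤ) = j := by exact_mod_cast this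
    omega
  · exact intCast_ne_intCast_add_half (-j) k (by push_cast; rw [← h]; ring)
  · have : ((-k - 1 : ℤ) : ℂ) = (j : ℂ) := by push_cast; linear_combination h
    have : (-k - 1 : ℤ) = j := by exact_mod_cast this
    omega

theorem sq_ne_sq_int {k m₂ : ℕ} : ∀ c ∈ catalanValues k m₂, c ^ 2 ≠ ((k : ℂ) + 1) ^ 2 := by
  intro c hc h
  rw [mem_catalanValues] at hc
  rcases sq_eq_sq_iff_eq_or_eq_neg.1 h with h | h <;> subst h <;>
    rcases hc with ⟨j, hj, h⟩ | ⟨j, hj, h⟩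
  · have : ((k + 1 : ℤ) : ℂ) = (j : ℂ) := by push_cast; linear_combination h
    have : (k + 1 : ℤ) = j := by exact_mod_cast this
    have := (abs_le.1 hj).2
    omega
  · exact intCast_ne_intCast_add_half (k + 1) j (by push_cast; rw [← h])
  · have : ((-(k + 1) : ℤ) : ℂ) = (j : ℂ) := by push_cast; linear_combination h
    have : (-(k + 1) : ℤ) = j := by exact_mod_cast this
    have := (abs_le.1 hj).1
    omega
  · exact intCast_ne_intCast_add_half (-(k + 1)) j (by push_cast; rw [← h])

theorem EquivLog.restrict_half {n m m₁ k : ℕ} {g : Fin (n + 1) → MvPolynomial (Fin (n + 1)) ℂ}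
    (hg : EquivLog (catalanValues m₁ (k + 1)) m g) :
    EquivLog (catalanValues m₁ (k + 1 + m)) m (restrictField ((k : ℂ) + 1 / 2) g) := by
  refine hg.restrict (half_mem_catalanValues m₁ k) fun c hc => ?_
  rw [mem_catalanValues] at hc ⊢
  rcases hc with h | ⟨j, hj, rfl⟩
  · exact Or.inl (Or.inl h)
  · by_cases h1 : -((k + 1 : ℕ) : ℤ) ≤ j ∧ j < (k + 1 : ℕ)
    · exact Or.inl (Or.inr ⟨j, h1, rfl⟩)
    · right
      rcases le_or_gt 0 j with h | h
      · left
        refine ⟨j - k, abs_le.2 (by omega), by push_cast; ring⟩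
      · right
        refine ⟨j + k + 1, abs_le.2 (by omega), by push_cast; ring⟩

theorem EquivLog.restrict_int {n m k m₂ : ℕ} {g : Fin (n + 1) → MvPolynomial (Fin (n + 1)) ℂ}
    (hg : EquivLog (catalanValues (k + 1) m₂) m g) :
    EquivLog (catalanValues (k + 1 + m) m₂) m (restrictField ((k : ℂ) + 1) g) := by
  refine hg.restrict (int_mem_catalanValues k m₂) fun c hc => ?_
  rw [mem_catalanValues] at hc ⊢
  rcases hc with ⟨j, hj, rfl⟩ | h
  · by_cases h1 : |j| ≤ (k + 1 : ℕ)
    · exact Or.inl (Or.inl ⟨j, h1, rfl⟩)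
    · right
      rw [abs_le] at hj h1
      rcases le_or_gt 0 j with h | h
      · left
        refine ⟨j - k - 1, abs_le.2 (by omega), by push_cast; ring⟩
      · right
        refine ⟨j + k + 1, abs_le.2 (by omega), by push_cast; ring⟩
  · exact Or.inl (Or.inr h)

/-- A field of low degree which is tangent to the integral hyperplanes is also tangent to
`x_i = ± 1/2`. -/
theorem EquivLog.half_of_degLE {n m m₁ : ℕ}
    {g : Fin (n + 1) → MvPolynomial (Fin (n + 1)) ℂ} (hg : EquivLog (catalanValues m₁ 0) m g)
    {D : ℤ} (hD : ∀ i, DegLE (g i) D) (hlt : D < 2 * m₁ + 1 + 2 * m * n) :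
    EquivLog (catalanValues m₁ 1) m g := by
  have hlast : restrictLast (1 / 2) (g (Fin.last n)) = 0 := by
    set T : Finset (Fin (n + 1) × ℂ) := {Fin.last n} ×ˢ intsUpTo m₁ with hT
    have hTc : T.card = 2 * m₁ + 1 := by
      rw [hT, Finset.card_product, card_intsUpTo]; simp
    obtain ⟨h, hh⟩ : linProd T ∣ g (Fin.last n) := by
      refine linProd_dvd fun t ht x hx => ?_
      obtain ⟨ht1, ht2⟩ := Finset.mem_product.1 ht
      rw [Finset.mem_singleton] at ht1
      refine hg.eq_zero _ x ?_
      rw [← ht1, hx]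
      exact Finset.mem_union_left _ ht2
    have hd := hD (Fin.last n)
    rw [hh] at hd
    have hd' := (hd.of_mul (linProd_ne_zero T)).restrictLast (c := 1 / 2)
    rw [totalDegree_linProd, hTc] at hd'
    have : restrictLast (1 / 2) h = 0 := by
      refine eq_zero_of_linProd (T := Finset.univ ×ˢ halfOdds m) (fun t ht x hx => ?_) hd' ?_
      · obtain ⟨j, hj, hjt⟩ := mem_halfOdds.1 (Finset.mem_product.1 ht).2
        rw [eval_restrictLast]
        set y : Fin (n + 1) → ℂ := Fin.snoc (α := fun _ => ℂ) x (1 / 2) with hy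
        have hne : Fin.last n ≠ t.1.castSucc := (Fin.castSucc_lt_last _).ne'
        have e1 := hg.eq_of_sub _ _ hne (-j) (abs_le.2 (by omega)) y
          (by simp [hy, hx, hjt])
        have e2 := hg.add_eq_zero hne (k := j + 1) (abs_le.2 (by omega)) (x := y)
          (by simp [hy, hx, hjt]; ring)
        have e3 : eval y (g (Fin.last n)) = 0 := by
          rw [← e1] at e2
          have : (2 : ℂ) * eval y (g (Fin.last n)) = 0 := by linear_combination e2
          simpa using this
        rw [hh, map_mul] at e3
        refine (mul_eq_zero.1 e3).resolve_left ?_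
        rw [linProd, map_prod]
        refine Finset.prod_ne_zero_iff.2 fun s hs => ?_
        obtain ⟨hs1, hs2⟩ := Finset.mem_product.1 hs
        rw [Finset.mem_singleton] at hs1
        obtain ⟨i, -, hi⟩ := mem_intsUpTo.1 hs2
        have := intCast_ne_intCast_add_half i 0
        rw [hs1, hi]
        simp only [hy, map_sub, eval_X, eval_C, Fin.snoc_last]
        rw [sub_ne_zero]
        simpa using this.symm
      · rw [Finset.card_product, card_halfOdds]
        simp only [Finset.card_univ, Fintype.card_fin]
        push_cast
        linarith
    rw [hh, map_mul, this, mul_zero]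
  have h1 : ∀ i (x : Fin (n + 1) → ℂ), x i = 1 / 2 → eval x (g i) = 0 := by
    intro i x hx
    have := hg.perm (Equiv.swap i (Fin.last n)) x (Fin.last n)
    rw [Equiv.swap_apply_right] at this
    rw [← this]
    have h2 := congrArg (eval (Fin.init (x ∘ Equiv.swap i (Fin.last n)))) hlast
    rw [eval_restrictLast] at h2
    have h3 : (1 / 2 : ℂ) = (x ∘ Equiv.swap i (Fin.last n)) (Fin.last n) := by simp [hx]
    rw [h3, Fin.snoc_init_self] at h2
    simpa using h2
  refine ⟨hg.perm, hg.flip_self, hg.flip_ne, fun i x hx => ?_, hg.eq_of_sub⟩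
  rw [mem_catalanValues] at hx
  rcases hx with h | ⟨j, hj, h⟩
  · exact hg.eq_zero i x (mem_catalanValues.2 (Or.inl h))
  · have : j = 0 ∨ j = -1 := by omega
    rcases this with rfl | rfl
    · exact h1 i x (by simpa using h)
    · have := h1 i (Function.update x i (-x i)) (by rw [Function.update_self, h]; norm_num)
      rw [hg.flip_self] at this
      exact neg_eq_zero.1 this

/-- There are no nonzero equivariant logarithmic fields of degree below the first exponent. -/
theorem EquivLog.eq_zero_of_degLE {m m₁ : ℕ} (n : ℕ) : ∀ (m₂ : ℕ)
    (g : Fin n → MvPolynomial (Fin n) ℂ) (D : ℤ), EquivLog (catalanValues m₁ m₂) m g →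
    (∀ i, DegLE (g i) D) → D < 2 * (m₁ + m₂) + 1 + 2 * m * ((n : ℤ) - 1) → g = 0 := by
  induction n with
  | zero => exact fun _ _ _ _ _ _ => funext fun i => i.elim0
  | succ n ihn =>
    suffices H : ∀ (b m₂ : ℕ) (g : Fin (n + 1) → MvPolynomial (Fin (n + 1)) ℂ) (D : ℤ),
        D < b → EquivLog (catalanValues m₁ m₂) m g → (∀ i, DegLE (g i) D) →
        D < 2 * (m₁ + m₂) + 1 + 2 * m * n → g = 0 by
      intro m₂ g D hg hD hlt
      refine H (D.toNat + 1) m₂ g D ?_ hg hD ?_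
      · push_cast
        have := Int.self_le_toNat D
        omega
      · push_cast at hlt
        simpa using hlt
    intro b
    induction b with
    | zero => exact fun m₂ g D hb _ hD _ => funext fun i => (hD i).eq_zero (by simpa using hb)
    | succ b ihb =>
      intro m₂ g D hb hg hD hlt
      obtain ⟨k, hg', hk⟩ : ∃ k : ℕ, EquivLog (catalanValues m₁ (k + 1)) m g ∧
          D < 2 * (m₁ + (k + 1)) + 1 + 2 * m * n := by
        rcases m₂ with _ | k
        · exact ⟨0, hg.half_of_degLE hD (by push_cast at hlt; linarith), by
            push_cast at hlt ⊢; linarith⟩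
        · exact ⟨k, hg, by push_cast at hlt; exact hlt⟩
      have hr : restrictField ((k : ℂ) + 1 / 2) g = 0 := by
        refine ihn _ _ D hg'.restrict_half (fun i => (hD _).restrictLast) ?_
        push_cast
        linarith
      obtain ⟨θ, hθ, hlog, hdeg⟩ := hg'.exists_eq_mul (half_mem_catalanValues m₁ k)
        (natCast_add_half_ne_zero k) hr (catalanValues_mono le_rfl (Nat.le_succ k)) sq_ne_sq_half
      have h0 : θ = 0 := by
        refine ihb k θ (D - 2 * (n + 1)) ?_ hlog (hdeg D hD) ?_
        · push_cast at hb; omega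
        · linarith
      exact funext fun i => by rw [hθ i, h0]; simp

section Deletion

variable {n m κ : ℕ} {C C' C'' : Finset ℂ} {c : ℂ}
  {φ : Fin (n + 1) → Fin (n + 1) → MvPolynomial (Fin (n + 1)) ℂ}
  {ψ : Fin n → Fin n → MvPolynomial (Fin n) ℂ}

/-- `A` is a homogeneous invariant coefficient vector of degree `2 k`. -/
structure IsCoeffVector (k : ℕ) (A : Fin (n + 1) → MvPolynomial (Fin (n + 1)) ℂ) : Prop where
  isWInvariant : ∀ l, IsWInvariant (A l)
  degLE : ∀ l, DegLE (A l) (2 * k - 2 * (l : ℕ))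

theorem IsCoeffVector.equivLog {k : ℕ} {A : Fin (n + 1) → MvPolynomial (Fin (n + 1)) ℂ}
    (hA : IsCoeffVector k A) (hφ : IsEquivBasis C (κ + 1) m φ) :
    EquivLog C m (fun i => ∑ l, A l * φ l i) :=
  EquivLog.sum (fun l _ => hA.isWInvariant l) fun l _ => hφ.equivLog l

theorem IsCoeffVector.degLE_sum {k : ℕ} {A : Fin (n + 1) → MvPolynomial (Fin (n + 1)) ℂ}
    (hA : IsCoeffVector k A) (hφ : IsEquivBasis C (κ + 1) m φ) (i : Fin (n + 1)) :
    DegLE (∑ l, A l * φ l i) (2 * κ + 3 + 2 * m * n + 2 * k) := by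
  refine DegLE.sum fun l _ => ((hA.degLE l).mul (hφ.degLE l i)).mono ?_
  simp only [basisDeg]
  push_cast
  linarith

/-- Eliminating the lower coefficients of the restriction of `φ k` with respect to `ψ`. -/
theorem exists_coeffVector (hC'' : C''.card = 2 * (κ + 1 + m) + 1)
    (hres : ∀ g : Fin (n + 1) → MvPolynomial (Fin (n + 1)) ℂ, EquivLog C m g →
      EquivLog C'' m (restrictField c g))
    (hφ : IsEquivBasis C (κ + 1) m φ) (hψ : IsEquivBasis C'' (κ + 1 + m) m ψ) (k : Fin (n + 1))
    (H : ∀ i : Fin n, (i : ℕ) < k → ∃ A : Fin (n + 1) → MvPolynomial (Fin (n + 1)) ℂ,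
      IsCoeffVector i A ∧ restrictField c (fun i => ∑ l, A l * φ l i) = ψ i) :
    ∃ A : Fin (n + 1) → MvPolynomial (Fin (n + 1)) ℂ, IsCoeffVector k A ∧ A k = 1 ∧
      ∃ b : Fin n → MvPolynomial (Fin n) ℂ, (∀ j, DegLE (b j) (2 * (k : ℕ) - 2 * (j : ℕ))) ∧
        ∀ i, restrictField c (fun i => ∑ l, A l * φ l i) i =
          ∑ j ∈ {j : Fin n | ¬ (j : ℕ) < k}, b j * ψ j i := by
  classical
  choose! A hA hAψ using H
  obtain ⟨b, hb, hbi, hbd⟩ := hψ.exists_coeff hC'' (hres _ (hφ.equivLog k))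
  have hbd' : ∀ j, DegLE (b j) (2 * (k : ℕ) - 2 * (j : ℕ)) := fun j =>
    (hbd _ (fun i => (hφ.degLE k _).restrictLast) j).mono (by
      simp only [basisDeg]; push_cast; linarith)
  choose B hBi hBd hB using fun j => exists_lift (hbi j) (hbd' j) c
  refine ⟨fun l => (if l = k then 1 else 0) - ∑ j ∈ {j : Fin n | (j : ℕ) < k}, B j * A j l,
    ⟨fun l => ?_, fun l => ?_⟩, ?_, b, hbd', fun i => ?_⟩
  · refine IsWInvariant.sub ?_ (IsWInvariant.sum fun j hj =>
      (hBi j).mul ((hA j (Finset.mem_filter.1 hj).2).isWInvariant l))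
    split_ifs
    · simpa using IsWInvariant.C (n := n + 1) 1
    · simpa using IsWInvariant.C (n := n + 1) 0
  · refine DegLE.sub ?_ (DegLE.sum fun j hj =>
      ((hBd j).mul ((hA j (Finset.mem_filter.1 hj).2).degLE l)).mono (by linarith))
    split_ifs with h
    · subst h; exact DegLE.one (by omega)
    · exact DegLE.zero
  · beta_reduce
    rw [if_pos rfl, Finset.sum_eq_zero, sub_zero]
    intro j hj
    have hj' := (Finset.mem_filter.1 hj).2
    rw [((hA j hj').degLE k).eq_zero (by omega), mul_zero]
  · have h1 : ∀ i',
        (∑ l, ((if l = k then 1 else 0) - ∑ j ∈ {j : Fin n | (j : ℕ) < k}, B j * A j l) * φ l i')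
        = φ k i' - ∑ j ∈ {j : Fin n | (j : ℕ) < k}, B j * ∑ l, A j l * φ l i' := by
      intro i'
      simp only [sub_mul, Finset.sum_sub_distrib, ite_mul, one_mul, zero_mul,
        Finset.sum_ite_eq', Finset.mem_univ, if_true, Finset.sum_mul, Finset.mul_sum]
      rw [Finset.sum_comm]
      simp only [mul_assoc]
    have h2 : ∀ j : Fin n, (j : ℕ) < k →
        restrictLast c (∑ l, A j l * φ l i.castSucc) = ψ j i := fun j hj =>
      congrFun (hAψ j hj) i
    have h3 : restrictLast c (φ k i.castSucc) = ∑ j, b j * ψ j i := hb i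
    simp only [restrictField, h1, map_sub, map_sum, map_mul, hB]
    simp only [← map_mul, ← map_sum]
    rw [h3, ← Finset.sum_filter_add_sum_filter_not Finset.univ (fun j : Fin n => (j : ℕ) < k)]
    have hs : ∑ j ∈ {j : Fin n | (j : ℕ) < k}, b j * restrictLast c (∑ l, A j l * φ l i.castSucc) =
        ∑ j ∈ {j : Fin n | (j : ℕ) < k}, b j * ψ j i :=
      Finset.sum_congr rfl fun j hj => by rw [h2 j (Finset.mem_filter.1 hj).2]
    rw [hs]
    ring

/-- Deletion: removing the hyperplanes `x_i = ± c` preserves freeness, provided the restriction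
is free with the matching exponents and the degrees of the fields of the deleted arrangement are
bounded below. -/
theorem IsEquivBasis.exists_deletion (hc : c ∈ C) (hc0 : c ≠ 0)
    (hC'' : C''.card = 2 * (κ + 1 + m) + 1)
    (hres : ∀ g : Fin (n + 1) → MvPolynomial (Fin (n + 1)) ℂ, EquivLog C m g →
      EquivLog C'' m (restrictField c g)) (hC' : C' ⊆ C)
    (hsq : ∀ c' ∈ C', c' ^ 2 ≠ c ^ 2)
    (hmin : ∀ (g : Fin (n + 1) → MvPolynomial (Fin (n + 1)) ℂ) (D : ℤ), EquivLog C' m g →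
      (∀ i, DegLE (g i) D) → D < 2 * κ + 1 + 2 * m * n → g = 0)
    (hφ : IsEquivBasis C (κ + 1) m φ) (hψ : IsEquivBasis C'' (κ + 1 + m) m ψ) :
    ∃ θ : Fin (n + 1) → Fin (n + 1) → MvPolynomial (Fin (n + 1)) ℂ, IsEquivBasis C' κ m θ := by
  classical
  have H : ∀ (k : ℕ) (i : Fin n), (i : ℕ) = k →
      ∃ A : Fin (n + 1) → MvPolynomial (Fin (n + 1)) ℂ,
        IsCoeffVector i A ∧ restrictField c (fun i => ∑ l, A l * φ l i) = ψ i := by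
    intro k
    induction k using Nat.strong_induction_on with
    | _ k ih =>
      rintro i rfl
      obtain ⟨A, hA, hAk, b, hbd, hAb⟩ := exists_coeffVector hC'' hres hφ hψ i.castSucc
        (fun j hj => ih j (by simpa using hj) j rfl)
      simp only [Fin.val_castSucc] at hA hbd hAb
      obtain ⟨γ, hγ⟩ := (hbd i).exists_C (by simp)
      have hAγ : ∀ j, restrictField c (fun i => ∑ l, A l * φ l i) j = MvPolynomial.C γ * ψ i j := by
        intro j
        rw [hAb, Finset.sum_eq_single i, hγ]
        · intro l hl hli
          have : (i : ℕ) < l := by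
            have := (Finset.mem_filter.1 hl).2
            have : (l : ℕ) ≠ i := fun h => hli (Fin.ext h)
            omega
          rw [(hbd l).eq_zero (by omega), zero_mul]
        · intro h; simp at h
      have hγ0 : γ ≠ 0 := by
        rintro rfl
        obtain ⟨θ, hθ, hlog, hdeg⟩ := (hA.equivLog hφ).exists_eq_mul hc hc0
          (funext fun j => by rw [hAγ j]; simp) hC' hsq
        have h0 : θ = 0 := by
          refine hmin θ _ hlog (hdeg _ (hA.degLE_sum hφ)) ?_
          have := i.2
          have h' : ((i : ℕ) : ℤ) < n := by exact_mod_cast this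
          linarith
        have := eq_zero_of_sum_eq_zero hφ.det_ne_zero (a := A)
          (fun j => by rw [hθ j, h0]; simp) i.castSucc
        rw [hAk] at this
        exact one_ne_zero this
      refine ⟨fun l => MvPolynomial.C γ⁻¹ * A l,
        ⟨fun l => (IsWInvariant.C _).mul (hA.isWInvariant l),
        fun l => (hA.degLE l).C_mul _⟩, funext fun j => ?_⟩
      have h1 := hAγ j
      simp only [restrictField] at h1 ⊢
      simp only [mul_assoc, ← Finset.mul_sum]
      rw [map_mul, h1]
      simp only [restrictLast, aeval_C, MvPolynomial.algebraMap_eq]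
      rw [← mul_assoc, ← C_mul, inv_mul_cancel₀ hγ0, C_1, one_mul]
  obtain ⟨A, hA, hAk, b, -, hAb⟩ := exists_coeffVector hC'' hres hφ hψ (Fin.last n)
    (fun j _ => H j j rfl)
  obtain ⟨θ, hθ, hlog, hdeg⟩ := (hA.equivLog hφ).exists_eq_mul hc hc0
    (funext fun j => by rw [hAb j]; simp) hC' hsq
  refine ⟨Fin.cons θ fun k => φ k.castSucc, ⟨fun k => ?_, fun k i => ?_, ?_⟩⟩
  · refine Fin.cases ?_ (fun k => ?_) k
    · simpa using hlog
    · simpa using (hφ.equivLog k.castSucc).mono hC'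
  · refine Fin.cases ?_ (fun k => ?_) k
    · refine (hdeg _ (hA.degLE_sum hφ) i).mono ?_
      simp only [basisDeg, Fin.val_last, Fin.val_zero]
      push_cast
      linarith
    · refine (hφ.degLE k.castSucc i).mono ?_
      simp only [basisDeg, Fin.val_castSucc, Fin.val_succ]
      push_cast
      linarith
  · set P : MvPolynomial (Fin (n + 1)) ℂ := linProd (Finset.univ ×ˢ {c, -c}) with hP
    refine det_ne_zero_of_sum fun a ha => ?_
    have hz := eq_zero_of_sum_eq_zero hφ.det_ne_zero
      (a := fun l => a 0 * A l +
        Fin.snoc (α := fun _ => MvPolynomial (Fin (n + 1)) ℂ) (fun k => P * a k.succ) 0 l)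
      (fun i => by
        have h1 := ha i
        rw [Fin.sum_univ_succ] at h1
        simp only [Fin.cons_zero, Fin.cons_succ] at h1
        simp only [add_mul, Finset.sum_add_distrib, mul_assoc, ← Finset.mul_sum]
        rw [hθ i, Fin.sum_univ_castSucc]
        simp only [Fin.snoc_castSucc, Fin.snoc_last, zero_mul, add_zero, mul_assoc,
          ← Finset.mul_sum]
        linear_combination P * h1)
    have h0 : a 0 = 0 := by simpa [hAk] using hz (Fin.last n)
    intro k
    refine Fin.cases h0 (fun k => ?_) k
    have := hz k.castSucc
    rw [h0, zero_mul, zero_add, Fin.snoc_castSucc] at this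
    exact (mul_eq_zero.1 this).resolve_left (linProd_ne_zero _)

end Deletion

section OddBernoulli

/-- The image of the Bernoulli polynomial in `ℂ[T]`. -/
def complexBernoulli (p : ℕ) : Polynomial ℂ := (Polynomial.bernoulli p).map (algebraMap ℚ ℂ)

/-- An odd polynomial whose central difference is the even part of `T ^ p`. -/
def oddBernoulli (p : ℕ) : Polynomial ℂ :=
  Polynomial.C (2 * ((p : ℂ) + 1))⁻¹ *
    ((complexBernoulli (p + 1)).comp (Polynomial.X + Polynomial.C (1 / 2)) -
      (complexBernoulli (p + 1)).comp (-Polynomial.X + Polynomial.C (1 / 2)))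

theorem eval_complexBernoulli_add_one (p : ℕ) (t : ℂ) :
    (complexBernoulli (p + 1)).eval (t + 1) =
      (complexBernoulli (p + 1)).eval t + (p + 1) * t ^ p := by
  have h := congrArg (fun q => (Polynomial.map (algebraMap ℚ ℂ) q).eval t)
    (Polynomial.bernoulli_comp_one_add_X (p + 1))
  simp only [Polynomial.map_comp, Polynomial.eval_comp] at h
  simpa [complexBernoulli, add_comm t 1] using h

theorem natDegree_complexBernoulli_le (p : ℕ) : (complexBernoulli p).natDegree ≤ p := by
  rw [Polynomial.natDegree_le_iff_coeff_eq_zero]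
  intro q hq
  simp [complexBernoulli, Polynomial.coeff_map, Polynomial.coeff_bernoulli, hq.not_ge]

theorem natDegree_oddBernoulli_le (p : ℕ) : (oddBernoulli p).natDegree ≤ p + 1 := by
  have h : ∀ q : Polynomial ℂ, q.natDegree ≤ 1 →
      ((complexBernoulli (p + 1)).comp q).natDegree ≤ p + 1 := fun q hq =>
    Polynomial.natDegree_comp_le.trans
      ((Nat.mul_le_mul (natDegree_complexBernoulli_le _) hq).trans (by omega))
  refine (Polynomial.natDegree_C_mul_le _ _).trans ((Polynomial.natDegree_sub_le _ _).trans
    (max_le (h _ ?_) (h _ ?_)))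
  · exact Polynomial.natDegree_X_add_C _ |>.le
  · compute_degree

theorem eval_oddBernoulli_neg (p : ℕ) (t : ℂ) :
    (oddBernoulli p).eval (-t) = -(oddBernoulli p).eval t := by
  simp [oddBernoulli]
  ring

theorem eval_oddBernoulli_sub (p : ℕ) (t : ℂ) :
    (oddBernoulli p).eval (t + 1 / 2) - (oddBernoulli p).eval (t - 1 / 2) =
      (t ^ p + (-t) ^ p) / 2 := by
  have hp : (p : ℂ) + 1 ≠ 0 := by exact_mod_cast p.succ_ne_zero
  have h1 := eval_complexBernoulli_add_one p t
  have h2 := eval_complexBernoulli_add_one p (-t)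
  simp only [oddBernoulli, Polynomial.eval_mul, Polynomial.eval_C, Polynomial.eval_sub,
    Polynomial.eval_comp, Polynomial.eval_add, Polynomial.eval_neg, Polynomial.eval_X]
  rw [show t + 1 / 2 + 1 / 2 = t + 1 by ring, show -(t + 1 / 2) + 1 / 2 = -t by ring,
    show t - 1 / 2 + 1 / 2 = t by ring, show -(t - 1 / 2) + 1 / 2 = -t + 1 by ring, h1, h2]
  field_simp
  ring

/-- The odd polynomial whose central difference is the even polynomial `K`, where `B` bounds the
degree of `K`. -/
def antidiff (B : ℕ) (K : Polynomial ℂ) : Polynomial ℂ :=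
  ∑ p ∈ Finset.range B, Polynomial.C (K.coeff p) * oddBernoulli p

theorem eval_antidiff_neg (B : ℕ) (K : Polynomial ℂ) (t : ℂ) :
    (antidiff B K).eval (-t) = -(antidiff B K).eval t := by
  simp [antidiff, Polynomial.eval_finsetSum, eval_oddBernoulli_neg]

theorem eval_antidiff_sub {B : ℕ} {K : Polynomial ℂ} (hB : K.natDegree < B)
    (hK : ∀ t, K.eval (-t) = K.eval t) (t : ℂ) :
    (antidiff B K).eval (t + 1 / 2) - (antidiff B K).eval (t - 1 / 2) = K.eval t := by
  have h : K.eval t = (K.eval t + K.eval (-t)) / 2 := by rw [hK]; ring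
  rw [h, Polynomial.eval_eq_sum_range' hB, Polynomial.eval_eq_sum_range' hB]
  simp only [antidiff, Polynomial.eval_finsetSum, Polynomial.eval_mul, Polynomial.eval_C]
  rw [← Finset.sum_sub_distrib, ← Finset.sum_add_distrib, Finset.sum_div]
  refine Finset.sum_congr rfl fun p _ => ?_
  rw [← mul_sub, eval_oddBernoulli_sub]
  ring

theorem natDegree_antidiff_le (B : ℕ) {K : Polynomial ℂ} {D : ℕ} (hK : K.natDegree ≤ D) :
    (antidiff B K).natDegree ≤ D + 1 := by
  refine Polynomial.natDegree_sum_le_of_forall_le _ _ fun p _ => ?_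
  by_cases hp : p ≤ D
  · exact (Polynomial.natDegree_C_mul_le _ _).trans ((natDegree_oddBernoulli_le p).trans (by omega))
  · rw [Polynomial.coeff_eq_zero_of_natDegree_lt (by omega)]
    simp

theorem antidiff_sum {ι : Type*} (s : Finset ι) (B : ℕ) (a : ι → ℂ) (K : ι → Polynomial ℂ) :
    antidiff B (∑ i ∈ s, Polynomial.C (a i) * K i) =
      ∑ i ∈ s, Polynomial.C (a i) * antidiff B (K i) := by
  simp only [antidiff, Polynomial.finsetSum_coeff, Polynomial.coeff_C_mul, map_sum, map_mul,
    Finset.sum_mul, Finset.mul_sum, mul_assoc]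
  exact Finset.sum_comm

end OddBernoulli

section Kernel

/-- The product of linear factors in `T` prescribing where a central difference vanishes. -/
def kernelPoly {R : Type*} [CommRing R] [Algebra ℂ R] {n : ℕ} (L m : ℕ) (x : Fin n → R) :
    Polynomial R :=
  (∏ q ∈ Finset.range L,
    (Polynomial.X ^ 2 - Polynomial.C (algebraMap ℂ R (((q : ℂ) / 2) ^ 2)))) *
  ∏ k ∈ Finset.range m, ∏ j,
    ((Polynomial.X + Polynomial.C (algebraMap ℂ R ((k : ℂ) - ((m : ℂ) - 1) / 2))) ^ 2 -
      Polynomial.C (x j ^ 2))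

variable {n : ℕ} (L m : ℕ)

theorem map_kernelPoly {R S : Type*} [CommRing R] [Algebra ℂ R] [CommRing S] [Algebra ℂ S]
    (f : R →ₐ[ℂ] S) (x : Fin n → R) :
    (kernelPoly L m x).map (f : R →+* S) = kernelPoly L m (fun i => f (x i)) := by
  simp [kernelPoly, Polynomial.map_prod]

theorem eval_kernelPoly (x : Fin n → ℂ) (t : ℂ) : (kernelPoly L m x).eval t =
    (∏ q ∈ Finset.range L, (t ^ 2 - ((q : ℂ) / 2) ^ 2)) *
      ∏ k ∈ Finset.range m, ∏ j, ((t + ((k : ℂ) - ((m : ℂ) - 1) / 2)) ^ 2 - x j ^ 2) := by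
  simp [kernelPoly, Polynomial.eval_prod]

theorem kernelPoly_ne_zero (x : Fin n → ℂ) : kernelPoly L m x ≠ 0 := by
  have h : ∀ a b : ℂ, ((Polynomial.X + Polynomial.C a) ^ 2 - Polynomial.C b).Monic := fun a b =>
    ((Polynomial.monic_X_add_C a).pow 2).sub_of_left (by
      rw [Polynomial.degree_pow, Polynomial.degree_X_add_C]
      exact Polynomial.degree_C_le.trans_lt (by norm_num))
  have h0 : ∀ b : ℂ, (Polynomial.X ^ 2 - Polynomial.C b).Monic := fun b => by simpa using h 0 b
  exact ((Polynomial.monic_prod_of_monic _ _ fun q _ => h0 _).mul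
    (Polynomial.monic_prod_of_monic _ _ fun k _ =>
      Polynomial.monic_prod_of_monic _ _ fun j _ => h _ _)).ne_zero

theorem eval_kernelPoly_neg (x : Fin n → ℂ) (t : ℂ) :
    (kernelPoly L m x).eval (-t) = (kernelPoly L m x).eval t := by
  rw [eval_kernelPoly, eval_kernelPoly, ← Finset.prod_range_reflect _ m]
  congr 1
  · simp
  · refine Finset.prod_congr rfl fun k hk => Finset.prod_congr rfl fun j _ => ?_
    have hk := Finset.mem_range.1 hk
    rw [show m - 1 - k = m - (k + 1) by omega, Nat.cast_sub hk]
    push_cast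
    ring

theorem eval_kernelPoly_half {q : ℤ} (hq : |q| < L) (x : Fin n → ℂ) :
    (kernelPoly L m x).eval ((q : ℂ) / 2) = 0 := by
  rw [eval_kernelPoly, Finset.prod_eq_zero (i := q.natAbs), zero_mul]
  · rw [Finset.mem_range]
    have := abs_lt.1 hq
    omega
  · have : ((q.natAbs : ℤ) : ℂ) ^ 2 = (q : ℂ) ^ 2 := by exact_mod_cast Int.natAbs_sq q
    rw [Int.cast_natCast] at this
    rw [div_pow, div_pow, this, sub_self]

theorem eval_kernelPoly_chain {k : ℕ} (hk : k < m) (x : Fin n → ℂ) (j : Fin n) :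
    (kernelPoly L m x).eval (x j + ((m : ℂ) - 1) / 2 - k) = 0 := by
  rw [eval_kernelPoly, Finset.prod_eq_zero (i := k) (Finset.mem_range.2 hk), mul_zero]
  rw [Finset.prod_eq_zero (Finset.mem_univ j)]
  ring

theorem kernelPoly_perm (σ : Equiv.Perm (Fin n)) (x : Fin n → ℂ) :
    kernelPoly L m (x ∘ σ) = kernelPoly L m x := by
  unfold kernelPoly
  congr 1
  refine Finset.prod_congr rfl fun k _ => ?_
  exact Equiv.prod_comp σ fun j => ((Polynomial.X +
    Polynomial.C (algebraMap ℂ ℂ ((k : ℂ) - ((m : ℂ) - 1) / 2))) ^ 2 - Polynomial.C (x j ^ 2))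

theorem kernelPoly_flip (i : Fin n) (x : Fin n → ℂ) :
    kernelPoly L m (Function.update x i (-x i)) = kernelPoly L m x := by
  unfold kernelPoly
  congr 1
  refine Finset.prod_congr rfl fun k _ => Finset.prod_congr rfl fun j _ => ?_
  by_cases h : j = i
  · subst h; simp
  · simp [h]

end Kernel

/-- Weighted degree at most `D`, the variable of the outer polynomial ring having weight one. -/
def WeightLE {σ : Type*} (P : Polynomial (MvPolynomial σ ℂ)) (D : ℤ) : Prop :=
  ∀ p, DegLE (P.coeff p) (D - p)

namespace WeightLE

variable {σ : Type*} {P Q : Polynomial (MvPolynomial σ ℂ)} {D E : ℤ}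

theorem mul (hP : WeightLE P D) (hQ : WeightLE Q E) : WeightLE (P * Q) (D + E) := by
  intro p
  rw [Polynomial.coeff_mul]
  refine DegLE.sum fun x hx => ((hP x.1).mul (hQ x.2)).mono ?_
  rw [← Finset.HasAntidiagonal.mem_antidiagonal.1 hx]
  push_cast
  linarith

theorem add (hP : WeightLE P D) (hQ : WeightLE Q D) : WeightLE (P + Q) D := fun p => by
  rw [Polynomial.coeff_add]; exact (hP p).add (hQ p)

theorem sub (hP : WeightLE P D) (hQ : WeightLE Q D) : WeightLE (P - Q) D := fun p => by
  rw [Polynomial.coeff_sub]; exact (hP p).sub (hQ p)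

theorem C {a : MvPolynomial σ ℂ} (ha : DegLE a D) : WeightLE (Polynomial.C a) D := fun p => by
  rw [Polynomial.coeff_C]
  split_ifs with h
  · simpa [h] using ha
  · exact DegLE.zero

theorem X : WeightLE (Polynomial.X : Polynomial (MvPolynomial σ ℂ)) 1 := fun p => by
  rw [Polynomial.coeff_X]
  split_ifs with h
  · subst h; exact DegLE.one (by simp)
  · exact DegLE.zero

theorem prod {ι : Type*} {s : Finset ι} {f : ι → Polynomial (MvPolynomial σ ℂ)}
    (h : ∀ i ∈ s, WeightLE (f i) D) : WeightLE (∏ i ∈ s, f i) (s.card * D) := by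
  classical
  induction s using Finset.induction_on with
  | empty => simpa using C (DegLE.one (σ := σ) (le_refl 0))
  | insert a s ha ih =>
    rw [Finset.prod_insert ha, Finset.card_insert_of_notMem ha]
    have := (h a (Finset.mem_insert_self a s)).mul
      (ih fun i hi => h i (Finset.mem_insert_of_mem hi))
    push_cast
    rwa [add_mul, one_mul, add_comm]

theorem pow (hP : WeightLE P D) (k : ℕ) : WeightLE (P ^ k) (k * D) := by
  simpa using prod (s := Finset.range k) (f := fun _ => P) fun _ _ => hP

end WeightLE

theorem weightLE_kernelPoly (n L m : ℕ) :
    WeightLE (kernelPoly L m (X : Fin n → MvPolynomial (Fin n) ℂ)) (2 * L + 2 * m * n) := by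
  have h2 : ∀ a : ℂ, WeightLE ((Polynomial.X + Polynomial.C (algebraMap ℂ
      (MvPolynomial (Fin n) ℂ) a)) ^ 2) 2 := fun a => by
    simpa using (WeightLE.X.add (WeightLE.C (DegLE.C a zero_le_one))).pow 2
  have h3 := (WeightLE.prod (s := Finset.range L) (D := 2) fun q _ =>
    ((WeightLE.X (σ := Fin n)).pow 2).sub
      (WeightLE.C (DegLE.C (((q : ℂ) / 2) ^ 2) (show (0 : ℤ) ≤ (2 : ℕ) * 1 by norm_num)))).mul
    (WeightLE.prod (s := Finset.range m) fun k _ => WeightLE.prod (s := Finset.univ) fun j _ =>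
      (h2 ((k : ℂ) - ((m : ℂ) - 1) / 2)).sub (WeightLE.C (by
        simpa using (DegLE.X j (le_refl 1)).pow 2)))
  simp only [Finset.card_range, Finset.card_univ, Fintype.card_fin] at h3
  have e : (L : ℤ) * 2 + m * (n * 2) = 2 * L + 2 * m * n := by ring
  rw [e] at h3
  exact h3

theorem natDegree_kernelPoly_le {n : ℕ} (L m : ℕ) (x : Fin n → ℂ) :
    (kernelPoly L m x).natDegree ≤ 2 * L + 2 * m * n := by
  have h := map_kernelPoly L m (aeval x : MvPolynomial (Fin n) ℂ →ₐ[ℂ] ℂ) X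
  simp only [aeval_X] at h
  rw [← h]
  refine Polynomial.natDegree_map_le.trans ?_
  rw [Polynomial.natDegree_le_iff_coeff_eq_zero]
  intro p hp
  refine (weightLE_kernelPoly n L m p).eq_zero ?_
  have : ((2 * L + 2 * m * n : ℕ) : ℤ) < p := by exact_mod_cast hp
  push_cast at this
  linarith

section Antidifference

variable {n L m B : ℕ} {x : Fin n → ℂ} {Q : Polynomial ℂ}

theorem eval_mul_kernelPoly_neg (hQ : ∀ t, Q.eval (-t) = Q.eval t) (t : ℂ) :
    (Q * kernelPoly L m x).eval (-t) = (Q * kernelPoly L m x).eval t := by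
  rw [Polynomial.eval_mul, Polynomial.eval_mul, hQ, eval_kernelPoly_neg]

theorem eval_antidiff_chain (hQ : ∀ t, Q.eval (-t) = Q.eval t)
    (hB : (Q * kernelPoly L m x).natDegree < B) (j : Fin n) {i : ℕ} (hi : i ≤ m) :
    (antidiff B (Q * kernelPoly L m x)).eval (x j + (m : ℂ) / 2 - i) =
      (antidiff B (Q * kernelPoly L m x)).eval (x j + (m : ℂ) / 2) := by
  induction i with
  | zero => simp
  | succ i ih =>
    rw [← ih (by omega)]
    have h := eval_antidiff_sub hB (eval_mul_kernelPoly_neg hQ) (x j + ((m : ℂ) - 1) / 2 - i)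
    rw [Polynomial.eval_mul, eval_kernelPoly_chain L m (by omega), mul_zero, sub_eq_zero] at h
    rw [show x j + (m : ℂ) / 2 - i = x j + ((m : ℂ) - 1) / 2 - i + 1 / 2 by ring, h]
    congr 1
    push_cast
    ring

theorem eval_antidiff_half (hL : 1 ≤ L) (hQ : ∀ t, Q.eval (-t) = Q.eval t)
    (hB : (Q * kernelPoly L m x).natDegree < B) {q : ℤ} (hq : |q| ≤ L) :
    (antidiff B (Q * kernelPoly L m x)).eval ((q : ℂ) / 2) = 0 := by
  have hdiff : ∀ q : ℤ, |q| < L → (antidiff B (Q * kernelPoly L m x)).eval (((q + 1 : ℤ) : ℂ) / 2) =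
      (antidiff B (Q * kernelPoly L m x)).eval (((q - 1 : ℤ) : ℂ) / 2) := by
    intro q hq
    have h := eval_antidiff_sub hB (eval_mul_kernelPoly_neg hQ) ((q : ℂ) / 2)
    rw [Polynomial.eval_mul, eval_kernelPoly_half L m hq, mul_zero, sub_eq_zero] at h
    convert! h using 2 <;> (push_cast; ring)
  have hodd : ∀ t, (antidiff B (Q * kernelPoly L m x)).eval (-t) =
      -(antidiff B (Q * kernelPoly L m x)).eval t := eval_antidiff_neg B _
  have hnat : ∀ q : ℕ, q ≤ L →
      (antidiff B (Q * kernelPoly L m x)).eval (((q : ℤ) : ℂ) / 2) = 0 := by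
    intro q
    induction q using Nat.strong_induction_on with
    | _ q ih =>
      intro hq
      match q with
      | 0 =>
        have := hodd 0
        rw [neg_zero] at this
        simpa using self_eq_neg.1 this
      | 1 =>
        have h := hdiff 0 (by simp; omega)
        have h2 := hodd (1 / 2)
        rw [show ((0 + 1 : ℤ) : ℂ) / 2 = 1 / 2 by norm_num,
          show ((0 - 1 : ℤ) : ℂ) / 2 = -(1 / 2) by norm_num, h2] at h
        simpa using self_eq_neg.1 h
      | q + 2 =>
        have h := hdiff (q + 1) (by rw [abs_of_nonneg (by positivity)]; omega)
        rw [show ((q : ℤ) + 1 - 1) = q by ring, ih q (by omega) (by omega)] at h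
        rw [← h]
        congr 3
  rcases le_total 0 q with h0 | h0
  · lift q to ℕ using h0
    exact hnat q (by simpa using hq)
  · obtain ⟨k, rfl⟩ : ∃ k : ℕ, q = -k := ⟨q.natAbs, by omega⟩
    have := hodd (((k : ℤ) : ℂ) / 2)
    rw [hnat k (by simpa using hq), neg_zero] at this
    rw [← this]
    congr 1
    push_cast
    ring

end Antidifference

section CatalanField

variable {n L m r : ℕ}

theorem eval_even_pow (r : ℕ) (t : ℂ) : (Polynomial.X ^ (2 * r)).eval (-t) =
    (Polynomial.X ^ (2 * r) : Polynomial ℂ).eval t := by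
  simp [pow_mul]

theorem natDegree_even_mul_kernelPoly_lt (hr : r < n) (x : Fin n → ℂ) :
    (Polynomial.X ^ (2 * r) * kernelPoly L m x).natDegree < 2 * n + 2 * L + 2 * m * n := by
  have h1 := natDegree_kernelPoly_le L m x
  have h2 := Polynomial.natDegree_mul_le (p := Polynomial.X ^ (2 * r)) (q := kernelPoly L m x)
  rw [Polynomial.natDegree_X_pow] at h2
  omega

/-- The equivariant logarithmic fields of the Catalan arrangement given by antidifferences. -/
def catalanField (n L m r : ℕ) (j : Fin n) : MvPolynomial (Fin n) ℂ :=
  ∑ p ∈ Finset.range (2 * n + 2 * L + 2 * m * n),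
    (Polynomial.X ^ (2 * r) * kernelPoly L m X).coeff p *
      Polynomial.aeval (X j + C ((m : ℂ) / 2)) (oddBernoulli p)

theorem eval_catalanField (j : Fin n) (x : Fin n → ℂ) : eval x (catalanField n L m r j) =
    (antidiff (2 * n + 2 * L + 2 * m * n) (Polynomial.X ^ (2 * r) * kernelPoly L m x)).eval
      (x j + (m : ℂ) / 2) := by
  have h := map_kernelPoly L m (aeval x : MvPolynomial (Fin n) ℂ →ₐ[ℂ] ℂ) X
  simp only [aeval_X] at h
  have h' : ∀ p, aeval x ((Polynomial.X ^ (2 * r) *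
      kernelPoly L m (X : Fin n → MvPolynomial (Fin n) ℂ)).coeff p) =
      (Polynomial.X ^ (2 * r) * kernelPoly L m x).coeff p := by
    intro p
    rw [← h, ← Polynomial.map_X (aeval (R := ℂ) x : MvPolynomial (Fin n) ℂ →+* ℂ),
      ← Polynomial.map_pow,
      ← Polynomial.map_mul, Polynomial.coeff_map]
    rfl
  rw [← coe_aeval_eq_eval]
  simp only [catalanField, antidiff, Polynomial.eval_finsetSum, Polynomial.eval_mul,
    Polynomial.eval_C, RingHom.coe_coe, map_sum, map_mul, h']
  refine Finset.sum_congr rfl fun p _ => ?_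
  rw [← Polynomial.aeval_algHom_apply]
  simp [Polynomial.aeval_def, Polynomial.eval₂_eq_eval_map]

theorem equivLog_catalanField {M : ℕ} (hL : 1 ≤ L) (hmL : m ≤ L) (hM : 2 * M = L + m)
    (hr : r < n) : EquivLog (catalanValues M M) m (catalanField n L m r) := by
  have hchain : ∀ (x : Fin n → ℂ) (j : Fin n) {i : ℕ}, i ≤ m →
      (antidiff (2 * n + 2 * L + 2 * m * n) (Polynomial.X ^ (2 * r) * kernelPoly L m x)).eval
        (x j + (m : ℂ) / 2 - i) = eval x (catalanField n L m r j) := fun x j i hi => by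
    rw [eval_antidiff_chain (eval_even_pow r) (natDegree_even_mul_kernelPoly_lt hr x) j hi,
      eval_catalanField]
  refine ⟨fun σ x i => ?_, fun i x => ?_, fun i j hij x => ?_, fun i x hx => ?_,
    fun i j _ k hk x hx => ?_⟩
  · rw [eval_catalanField, eval_catalanField, kernelPoly_perm, Function.comp_apply]
  · rw [eval_catalanField, kernelPoly_flip, Function.update_self, ← hchain x i le_rfl,
      ← eval_antidiff_neg]
    congr 1
    ring
  · rw [eval_catalanField, eval_catalanField, kernelPoly_flip, Function.update_of_ne hij]
  · obtain ⟨s, hs, hxs⟩ : ∃ s : ℤ, |s| ≤ 2 * M ∧ x i = (s : ℂ) / 2 := by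
      rcases mem_catalanValues.1 hx with ⟨j, hj, h⟩ | ⟨j, hj, h⟩
      · exact ⟨2 * j, by rw [abs_le] at hj ⊢; omega, by rw [h]; push_cast; ring⟩
      · exact ⟨2 * j + 1, by rw [abs_le]; omega, by rw [h]; push_cast; ring⟩
    have hs := abs_le.1 hs
    have key : ∀ {i' : ℕ}, i' ≤ m → |s + m - 2 * i'| ≤ L →
        eval x (catalanField n L m r i) = 0 := by
      intro i' hi' h
      rw [← hchain x i hi', ← eval_antidiff_half hL (eval_even_pow r)
        (natDegree_even_mul_kernelPoly_lt hr x) h, hxs]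
      congr 1
      push_cast
      ring
    rcases le_total 0 s with h0 | h0
    · exact key le_rfl (by rw [abs_le]; omega)
    · exact key (Nat.zero_le m) (by rw [abs_le]; push_cast; omega)
  · have key : ∀ (i j : Fin n) (k : ℕ), k ≤ m → x i - x j = k →
        eval x (catalanField n L m r i) = eval x (catalanField n L m r j) := by
      intro i j k hk hx
      rw [← hchain x i hk, eval_catalanField]
      congr 1
      linear_combination hx
    rcases le_total 0 k with h0 | h0
    · lift k to ℕ using h0
      exact key i j k (by simpa using hk) (by simpa using hx)
    · obtain ⟨l, rfl⟩ : ∃ l : ℕ, k = -l := ⟨k.natAbs, by omega⟩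
      refine (key j i l (by simpa using hk) ?_).symm
      push_cast at hx
      linear_combination -hx

theorem DegLE.polynomial_aeval {σ : Type*} {t : MvPolynomial σ ℂ} (ht : DegLE t 1)
    {q : Polynomial ℂ} {d : ℕ} (hq : q.natDegree ≤ d) : DegLE (Polynomial.aeval t q) d := by
  rw [Polynomial.aeval_eq_sum_range]
  refine DegLE.sum fun i hi => ?_
  rw [MvPolynomial.smul_eq_C_mul]
  refine ((ht.pow i).mono ?_).C_mul _
  have := Finset.mem_range.1 hi
  rw [mul_one]
  exact_mod_cast (Nat.lt_succ_iff.1 this).trans hq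

theorem degLE_catalanField (j : Fin n) :
    DegLE (catalanField n L m r j) (2 * r + 2 * L + 2 * m * n + 1) := by
  refine DegLE.sum fun p _ => ?_
  have h1 := (((WeightLE.X (σ := Fin n)).pow (2 * r)).mul (weightLE_kernelPoly n L m)) p
  have h2 := ((DegLE.X j (le_refl 1)).add (DegLE.C ((m : ℂ) / 2) zero_le_one)).polynomial_aeval
    (natDegree_oddBernoulli_le p)
  refine (h1.mul h2).mono ?_
  push_cast
  linarith

end CatalanField

section CatalanBasis

variable {n L m : ℕ}

/-- The roots of an antidifference vanishing on the chains of the points `I`, `2 I`, …. -/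
def chainRoot (n L m : ℕ) :
    (ℤˣ × Fin n × Fin (m + 1)) ⊕ Finset.Icc (-(L : ℤ)) L → ℂ
  | .inl (s, j, i) => ((s : ℤ) : ℂ) * (Complex.I * ((j : ℕ) + 1) + (m : ℂ) / 2 - (i : ℕ))
  | .inr q => ((q : ℤ) : ℂ) / 2

theorem chainRoot_im (s : ℤˣ) (j : Fin n) (i : Fin (m + 1)) :
    (chainRoot n L m (.inl (s, j, i))).im = (((s : ℤ) * ((j : ℕ) + 1) : ℤ) : ℝ) := by
  have h : chainRoot n L m (.inl (s, j, i)) = (((s : ℤ) * ((m : ℝ) / 2 - (i : ℕ)) : ℝ) : ℂ) +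
      (((s : ℤ) * ((j : ℕ) + 1) : ℝ) : ℂ) * Complex.I := by
    simp only [chainRoot]; push_cast; ring
  rw [h, Complex.add_im, Complex.ofReal_im, Complex.im_ofReal_mul, Complex.I_im]
  push_cast
  ring

theorem chainRoot_injective : Function.Injective (chainRoot n L m) := by
  have him : ∀ q : Finset.Icc (-(L : ℤ)) L, (chainRoot n L m (.inr q)).im = 0 := by
    intro q
    have : chainRoot n L m (.inr q) = (((q : ℤ) / 2 : ℝ) : ℂ) := by simp [chainRoot]
    rw [this, Complex.ofReal_im]
  have hne : ∀ (s : ℤˣ) (j : Fin n), (s : ℤ) * ((j : ℕ) + 1) ≠ 0 := fun s j =>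
    mul_ne_zero s.ne_zero (by positivity)
  rintro (⟨s, j, i⟩ | q) (⟨s', j', i'⟩ | q') h
  · have h1 : (s : ℤ) * ((j : ℕ) + 1) = s' * ((j' : ℕ) + 1) := by
      have := congrArg Complex.im h
      rw [chainRoot_im, chainRoot_im] at this
      exact_mod_cast this
    have hs : s = s' := by
      rcases Int.units_eq_one_or s with rfl | rfl <;> rcases Int.units_eq_one_or s' with rfl | rfl
      · rfl
      · push_cast at h1; omega
      · push_cast at h1; omega
      · rfl
    subst hs
    have hj : (j : ℕ) = j' := by
      have := mul_left_cancel₀ s.ne_zero h1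
      omega
    obtain rfl := Fin.ext hj
    have hs : (((s : ℤˣ) : ℤ) : ℂ) ≠ 0 := by exact_mod_cast s.ne_zero
    have hi : ((i : ℕ) : ℂ) = ((i' : ℕ) : ℂ) := by
      have := mul_left_cancel₀ hs h
      linear_combination -this
    rw [Fin.ext (by exact_mod_cast hi : (i : ℕ) = i')]
  · have := congrArg Complex.im h
    rw [chainRoot_im, him] at this
    exact absurd (by exact_mod_cast this) (hne s j)
  · have := congrArg Complex.im h
    rw [chainRoot_im, him] at this
    exact absurd (by exact_mod_cast this.symm) (hne s' j')
  · have h : ((q : ℤ) : ℂ) / 2 = ((q' : ℤ) : ℂ) / 2 := h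
    have : ((q : ℤ) : ℂ) = ((q' : ℤ) : ℂ) := by linear_combination 2 * h
    rw [Subtype.ext (by exact_mod_cast this : (q : ℤ) = q')]

theorem card_chainRoot : Fintype.card ((ℤˣ × Fin n × Fin (m + 1)) ⊕ Finset.Icc (-(L : ℤ)) L) =
    2 * (n * (m + 1)) + (2 * L + 1) := by
  simp only [Fintype.card_sum, Fintype.card_prod, Fintype.card_units_int, Fintype.card_fin,
    Fintype.card_coe, Int.card_Icc]
  omega

theorem det_catalanField_ne_zero (hL : 1 ≤ L) :
    Matrix.det (Matrix.of fun r : Fin n => catalanField n L m r) ≠ 0 := by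
  set x : Fin n → ℂ := fun j => Complex.I * ((j : ℕ) + 1) with hx
  suffices h : Matrix.det (Matrix.of fun r j : Fin n => eval x (catalanField n L m r j)) ≠ 0 by
    intro h0
    apply h
    have := congrArg (eval x) h0
    rw [RingHom.map_det, map_zero] at this
    exact this
  refine det_ne_zero_of_sum fun a ha k => ?_
  set Q : Polynomial ℂ := ∑ r : Fin n, Polynomial.C (a r) * Polynomial.X ^ (2 * (r : ℕ)) with hQdef
  have hn : 1 ≤ n := by have := k.2; omega
  have hQ : ∀ t, Q.eval (-t) = Q.eval t := fun t => by
    simp only [hQdef, Polynomial.eval_finsetSum, Polynomial.eval_mul, eval_even_pow,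
      Polynomial.eval_C]
  have hdeg : (Q * kernelPoly L m x).natDegree ≤ 2 * n + 2 * L + 2 * m * n - 2 := by
    have h1 := natDegree_kernelPoly_le L m x
    have h2 := Polynomial.natDegree_mul_le (p := Q) (q := kernelPoly L m x)
    have h3 : Q.natDegree ≤ 2 * n - 2 := Polynomial.natDegree_sum_le_of_forall_le _ _ fun r _ =>
      (Polynomial.natDegree_C_mul_X_pow_le _ _).trans (by have := r.2; omega)
    omega
  have hB : (Q * kernelPoly L m x).natDegree < 2 * n + 2 * L + 2 * m * n := by omega
  set u := antidiff (2 * n + 2 * L + 2 * m * n) (Q * kernelPoly L m x) with hu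
  have hzero : ∀ j, u.eval (x j + (m : ℂ) / 2) = 0 := by
    intro j
    rw [← ha j, hu, hQdef, Finset.sum_mul]
    simp only [mul_assoc, antidiff_sum, Polynomial.eval_finsetSum, Polynomial.eval_mul,
      Polynomial.eval_C, eval_catalanField]
  have hu0 : u = 0 := by
    refine Polynomial.eq_zero_of_natDegree_lt_card_of_eval_eq_zero u
      (chainRoot_injective (n := n) (L := L) (m := m)) ?_ ?_
    · rintro (⟨s, j, i⟩ | q)
      · have h1 : u.eval (x j + (m : ℂ) / 2 - (i : ℕ)) = 0 := by
          rw [hu, eval_antidiff_chain hQ hB j (Nat.lt_succ_iff.1 i.2), ← hu, hzero]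
        rcases Int.units_eq_one_or s with rfl | rfl
        · simpa [chainRoot] using h1
        · have h2 := eval_antidiff_neg (2 * n + 2 * L + 2 * m * n) (Q * kernelPoly L m x)
            (x j + (m : ℂ) / 2 - (i : ℕ))
          rw [← hu, h1, neg_zero] at h2
          simpa [chainRoot] using h2
      · exact eval_antidiff_half hL hQ hB (abs_le.2 (Finset.mem_Icc.1 q.2))
    · refine (natDegree_antidiff_le _ hdeg).trans_lt ?_
      rw [card_chainRoot]
      have : 2 * (n * (m + 1)) = 2 * m * n + 2 * n := by ring
      omega
  have hQK : Q * kernelPoly L m x = 0 := Polynomial.funext fun t => by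
    rw [← eval_antidiff_sub hB (eval_mul_kernelPoly_neg hQ) t, ← hu, hu0]
    simp
  have hQ0 := (mul_eq_zero.1 hQK).resolve_right (kernelPoly_ne_zero L m x)
  have := congrArg (fun q : Polynomial ℂ => q.coeff (2 * (k : ℕ))) hQ0
  simpa [hQdef, Polynomial.finsetSum_coeff, Polynomial.coeff_X_pow, Fin.val_inj] using this

theorem isEquivBasis_catalanField {M : ℕ} (hL : 1 ≤ L) (hmL : m ≤ L) (hM : 2 * M = L + m) :
    IsEquivBasis (catalanValues M M) (M + M) m fun r : Fin n => catalanField n L m r where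
  equivLog r := equivLog_catalanField hL hmL hM r.2
  degLE r j := (degLE_catalanField j).mono (by
    have hM' : (2 : ℤ) * M = L + m := by exact_mod_cast hM
    simp only [basisDeg]
    push_cast
    linarith)
  det_ne_zero := det_catalanField_ne_zero hL

/-- The extended Catalan arrangement has a basis of equivariant logarithmic fields. -/
theorem exists_isEquivBasis (m n : ℕ) : ∀ m₁ m₂ : ℕ,
    ∃ θ : Fin n → Fin n → MvPolynomial (Fin n) ℂ,
      IsEquivBasis (catalanValues m₁ m₂) (m₁ + m₂) m θ := by
  induction n with
  | zero =>
    exact fun m₁ m₂ => ⟨fun k => k.elim0, fun k => k.elim0, fun k => k.elim0, by simp⟩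
  | succ n ihn =>
    have hmin : ∀ (m₁ m₂ : ℕ) (g : Fin (n + 1) → MvPolynomial (Fin (n + 1)) ℂ) (D : ℤ),
        EquivLog (catalanValues m₁ m₂) m g → (∀ i, DegLE (g i) D) →
        D < 2 * (m₁ + m₂ : ℕ) + 1 + 2 * m * n → g = 0 := fun m₁ m₂ g D hg hD hlt =>
      hg.eq_zero_of_degLE (n + 1) m₂ g D hD (by push_cast at hlt ⊢; linarith)
    have half : ∀ m₁ k : ℕ, (∃ θ : Fin (n + 1) → Fin (n + 1) → MvPolynomial (Fin (n + 1)) ℂ,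
        IsEquivBasis (catalanValues m₁ (k + 1)) (m₁ + (k + 1)) m θ) →
        ∃ θ : Fin (n + 1) → Fin (n + 1) → MvPolynomial (Fin (n + 1)) ℂ,
          IsEquivBasis (catalanValues m₁ k) (m₁ + k) m θ := by
      rintro m₁ k ⟨φ, hφ⟩
      obtain ⟨ψ, hψ⟩ := ihn m₁ (k + 1 + m)
      rw [show m₁ + (k + 1 + m) = m₁ + k + 1 + m by ring] at hψ
      exact hφ.exists_deletion (half_mem_catalanValues m₁ k) (natCast_add_half_ne_zero k)
        (by rw [card_catalanValues]; ring) (fun g hg => hg.restrict_half)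
        (catalanValues_mono le_rfl (Nat.le_succ k)) sq_ne_sq_half (hmin m₁ k) hψ
    have int : ∀ k m₂ : ℕ, (∃ θ : Fin (n + 1) → Fin (n + 1) → MvPolynomial (Fin (n + 1)) ℂ,
        IsEquivBasis (catalanValues (k + 1) m₂) (k + 1 + m₂) m θ) →
        ∃ θ : Fin (n + 1) → Fin (n + 1) → MvPolynomial (Fin (n + 1)) ℂ,
          IsEquivBasis (catalanValues k m₂) (k + m₂) m θ := by
      rintro k m₂ ⟨φ, hφ⟩
      obtain ⟨ψ, hψ⟩ := ihn (k + 1 + m) m₂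
      rw [show k + 1 + m + m₂ = k + m₂ + 1 + m by ring] at hψ
      rw [show k + 1 + m₂ = k + m₂ + 1 by ring] at hφ
      exact hφ.exists_deletion (int_mem_catalanValues k m₂) (Nat.cast_add_one_ne_zero k)
        (by rw [card_catalanValues]; ring) (fun g hg => hg.restrict_int)
        (catalanValues_mono (Nat.le_succ k) le_rfl) sq_ne_sq_int (hmin k m₂) hψ
    intro m₁ m₂
    set M := m₁ + m₂ + m + 1 with hM
    have base : ∃ θ : Fin (n + 1) → Fin (n + 1) → MvPolynomial (Fin (n + 1)) ℂ,
        IsEquivBasis (catalanValues M M) (M + M) m θ :=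
      ⟨_, isEquivBasis_catalanField (L := 2 * M - m) (by omega) (by omega) (by omega)⟩
    have base' := Nat.decreasingInduction' (P := fun k =>
      ∃ θ : Fin (n + 1) → Fin (n + 1) → MvPolynomial (Fin (n + 1)) ℂ,
        IsEquivBasis (catalanValues M k) (M + k) m θ) (fun k _ _ h => half M k h)
      (show m₂ ≤ M by omega) base
    exact Nat.decreasingInduction' (P := fun k =>
      ∃ θ : Fin (n + 1) → Fin (n + 1) → MvPolynomial (Fin (n + 1)) ℂ,
        IsEquivBasis (catalanValues k m₂) (k + m₂) m θ) (fun k _ _ h => int k m₂ h)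
      (show m₁ ≤ M by omega) base'

end CatalanBasis

section Cone

variable {n : ℕ}

theorem isConeVar_last (n : ℕ) :
    IsConeVar (Fin.castSucc : Fin n → Fin (n + 1)) (X (Fin.last n)) where
  injective := Fin.castSucc_injective n
  indepOf i x a := by simp [(Fin.castSucc_lt_last i).ne']
  exists_point x := ⟨Fin.snoc (α := fun _ => ℂ) x 1, by simp, by simp⟩
  degLE := DegLE.X _ le_rfl

/-- Homogenization in degree `d` with respect to the last variable. -/
def homogenize (d : ℕ) (p : MvPolynomial (Fin n) ℂ) : MvPolynomial (Fin (n + 1)) ℂ :=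
  ∑ s ∈ p.support,
    C (coeff s p) * ((∏ i, X (Fin.castSucc i) ^ s i) * X (Fin.last n) ^ (d - s.degree))

theorem degree_le_of_mem_support {p : MvPolynomial (Fin n) ℂ} {d : ℕ} (hp : DegLE p d)
    {s : Fin n →₀ ℕ} (hs : s ∈ p.support) : s.degree ≤ d := by
  exact_mod_cast hp s hs

theorem DegLE.homogenize {p : MvPolynomial (Fin n) ℂ} {d : ℕ} (hp : DegLE p d) :
    DegLE (homogenize d p) d := by
  refine DegLE.sum fun s hs => DegLE.C_mul _ ?_
  have h1 : DegLE (∏ i, (MvPolynomial.X (Fin.castSucc i) : MvPolynomial (Fin (n + 1)) ℂ) ^ s i)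
      (∑ i, ((s i : ℕ) : ℤ)) := DegLE.prod fun i _ => by
    simpa using (DegLE.X (Fin.castSucc i) (le_refl 1)).pow (s i)
  refine (h1.mul ((DegLE.X (Fin.last n) (le_refl 1)).pow (d - s.degree))).mono ?_
  have h2 := degree_le_of_mem_support hp hs
  have h3 : ∑ i, ((s i : ℕ) : ℤ) = (s.degree : ℤ) := by
    rw [Finsupp.degree_eq_sum]; push_cast; rfl
  rw [h3]
  push_cast [Nat.cast_sub h2]
  linarith

theorem eval_homogenize {p : MvPolynomial (Fin n) ℂ} {d : ℕ} (hp : DegLE p d) (x : Fin n → ℂ)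
    (z : ℂ) : eval (Fin.snoc (α := fun _ => ℂ) (fun i => z * x i) z) (homogenize d p) =
      z ^ d * eval x p := by
  rw [eval_eq' x p, Finset.mul_sum, homogenize, map_sum]
  refine Finset.sum_congr rfl fun s hs => ?_
  simp only [map_mul, eval_C, map_prod, map_pow, eval_X, Fin.snoc_castSucc, Fin.snoc_last, mul_pow,
    Finset.prod_mul_distrib, Finset.prod_pow_eq_pow_sum, ← Finsupp.degree_eq_sum]
  rw [← Nat.add_sub_of_le (degree_le_of_mem_support hp hs), pow_add, Nat.add_sub_cancel_left]
  ring

theorem restrictLast_homogenize {p : MvPolynomial (Fin n) ℂ} {d : ℕ} (hp : DegLE p d) :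
    restrictLast 1 (homogenize d p) = p := by
  apply MvPolynomial.funext
  intro x
  have := eval_homogenize hp x 1
  rw [eval_restrictLast]
  simpa using this

theorem EquivLog.form_dvd_homogenize {m d : ℕ} {C : Finset ℂ}
    {g : Fin n → MvPolynomial (Fin n) ℂ} (hg : EquivLog C m g) (hd : ∀ i, DegLE (g i) d)
    (h : HypIndex n C m) : X (Fin.castSucc h.lead) - h.rest Fin.castSucc (X (Fin.last n)) ∣
      ∑ i, h.weight (Fin (n + 1)) i * homogenize d (g i) := by
  have hind := h.indepOf_rest (isConeVar_last n)
  have hdvd : X (Fin.castSucc h.lead) - h.rest Fin.castSucc (X (Fin.last n)) ∣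
      X (Fin.last n) * ∑ i, h.weight (Fin (n + 1)) i * homogenize d (g i) := by
    rw [sub_dvd_iff_eval hind]
    intro y hy
    rw [map_mul, eval_X, mul_eq_zero]
    by_cases hz : y (Fin.last n) = 0
    · exact Or.inl hz
    right
    obtain ⟨z, hyz⟩ : ∃ z, z = y (Fin.last n) := ⟨_, rfl⟩
    rw [← hyz] at hz
    obtain ⟨x, rfl⟩ : ∃ x : Fin n → ℂ, y = Fin.snoc (α := fun _ => ℂ) (fun i => z * x i) z :=
      ⟨fun i => y i.castSucc / z, funext fun i => by
        refine Fin.lastCases ?_ (fun i => ?_) i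
        · simp [hyz]
        · simp [mul_div_cancel₀ _ hz]⟩
    have hx : x (id h.lead) = eval x (h.rest id 1) := by
      apply mul_left_cancel₀ hz
      rw [Fin.snoc_castSucc] at hy
      rw [id, hy]
      rcases h with ⟨i, c⟩ | ⟨⟨⟨i, j⟩, hij⟩, k⟩
      · simp only [HypIndex.rest, map_mul, eval_C, eval_X, Fin.snoc_last, map_one]; ring
      · simp [HypIndex.rest]; ring
    have hw : ∀ i, eval (Fin.snoc (α := fun _ => ℂ) (fun i => z * x i) z)
        (h.weight (Fin (n + 1)) i) = eval x (h.weight (Fin n) i) := by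
      intro l
      rcases h with ⟨i, c⟩ | ⟨⟨⟨i, j⟩, hij⟩, k⟩
      · simp only [HypIndex.weight, Pi.single_apply]
        split_ifs <;> simp
      · simp only [HypIndex.weight, Pi.sub_apply, Pi.single_apply, map_sub]
        split_ifs <;> simp
    have h0 := (sub_dvd_iff_eval (h.indepOf_rest (isConeVar_affine n)) _).1 (hg.form_dvd h) x hx
    simp only [map_sum, map_mul, hw, eval_homogenize (hd _)] at h0 ⊢
    rw [← mul_zero (z ^ d), ← h0, Finset.mul_sum]
    exact Finset.sum_congr rfl fun i _ => by ring
  refine ((prime_sub hind).dvd_or_dvd hdvd).resolve_left fun hlast => ?_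
  have := (sub_dvd_iff_eval hind _).1 hlast (Function.update (fun _ => 1) h.lead.castSucc
    (eval (fun _ => 1) (h.rest Fin.castSucc (X (Fin.last n))))) (by
      rw [Function.update_self, hind])
  rw [eval_X, Function.update_of_ne (Fin.castSucc_lt_last _).ne'] at this
  exact one_ne_zero this

/-- The constant term of the affine equation of a hyperplane. -/
def HypIndex.const {C : Finset ℂ} {m : ℕ} (h : HypIndex n C m) : ℂ :=
  match h with
  | .inl (_, c) => c
  | .inr (_, k) => ((k : ℤ) : ℂ)

/-- The value of a linear form of the cone on a coefficient vector. -/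
def HypIndex.apply {C : Finset ℂ} {m : ℕ} (h : HypIndex n C m)
    (g : Fin (n + 1) → MvPolynomial (Fin (n + 1)) ℂ) : MvPolynomial (Fin (n + 1)) ℂ :=
  (∑ i, h.weight (Fin (n + 1)) i * g (Fin.castSucc i)) -
    MvPolynomial.C h.const * g (Fin.last n)

theorem HypIndex.apply_X {C : Finset ℂ} {m : ℕ} (h : HypIndex n C m) :
    h.apply X = X (Fin.castSucc h.lead) - h.rest Fin.castSucc (X (Fin.last n)) := by
  rw [HypIndex.apply, HypIndex.sum_weight]
  rcases h with ⟨i, c⟩ | ⟨⟨⟨i, j⟩, hij⟩, k⟩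
  · rfl
  · simp [HypIndex.lead, HypIndex.rest, HypIndex.const, sub_sub]

theorem HypIndex.apply_inl {C : Finset ℂ} {m : ℕ} (i : Fin n) (c : C)
    (g : Fin (n + 1) → MvPolynomial (Fin (n + 1)) ℂ) :
    HypIndex.apply (.inl (i, c) : HypIndex n C m) g =
      g (Fin.castSucc i) - MvPolynomial.C (c : ℂ) * g (Fin.last n) := by
  rw [HypIndex.apply, HypIndex.sum_weight]; rfl

theorem HypIndex.apply_inr_of_lt {C : Finset ℂ} {m : ℕ} {i j : Fin n} (hij : i < j)
    (k : Finset.Icc (-(m : ℤ)) m) (g : Fin (n + 1) → MvPolynomial (Fin (n + 1)) ℂ) :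
    HypIndex.apply (.inr (⟨(i, j), hij.ne⟩, k) : HypIndex n C m) g =
      g (Fin.castSucc i) - g (Fin.castSucc j) - MvPolynomial.C ((k : ℤ) : ℂ) * g (Fin.last n) := by
  rw [HypIndex.apply, HypIndex.sum_weight]
  simp [pairSign, hij, HypIndex.const]

theorem HypIndex.apply_inr_of_gt {C : Finset ℂ} {m : ℕ} {i j : Fin n} (hij : i < j)
    (k : Finset.Icc (-(m : ℤ)) m) (g : Fin (n + 1) → MvPolynomial (Fin (n + 1)) ℂ) :
    HypIndex.apply (.inr (⟨(j, i), hij.ne'⟩, k) : HypIndex n C m) g =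
      g (Fin.castSucc i) + g (Fin.castSucc j) - MvPolynomial.C ((k : ℤ) : ℂ) * g (Fin.last n) := by
  rw [HypIndex.apply, HypIndex.sum_weight]
  simp [pairSign, hij.not_gt, HypIndex.const, add_comm]

theorem HypIndex.two_mul_apply_inl {C : Finset ℂ} {m : ℕ} (i : Fin n) (c : C) {a : ℂ}
    (ha : 2 * (c : ℂ) = a) (g : Fin (n + 1) → MvPolynomial (Fin (n + 1)) ℂ) :
    MvPolynomial.C 2 * HypIndex.apply (.inl (i, c) : HypIndex n C m) g =
      MvPolynomial.C 2 * g (Fin.castSucc i) - MvPolynomial.C a * g (Fin.last n) := by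
  rw [HypIndex.apply_inl, ← ha, C_mul]; ring

theorem mem_DcBCCat_iff {m₁ m₂ m₃ : ℕ} {g : Fin (n + 1) → MvPolynomial (Fin (n + 1)) ℂ} :
    g ∈ DcBCCat n m₁ m₂ m₃ ↔ X (Fin.last n) ∣ g (Fin.last n) ∧
      ∀ h : HypIndex n (catalanValues m₁ m₂) m₃, h.apply X ∣ h.apply g := by
  have h2 : (MvPolynomial.C 2 : MvPolynomial (Fin (n + 1)) ℂ) ≠ 0 := by simp
  have hscale : ∀ (i : Fin n) (c : catalanValues m₁ m₂) (a : ℂ), 2 * (c : ℂ) = a →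
      ((MvPolynomial.C 2 * X (Fin.castSucc i) - MvPolynomial.C a * X (Fin.last n) ∣
        MvPolynomial.C 2 * g (Fin.castSucc i) - MvPolynomial.C a * g (Fin.last n)) ↔
      HypIndex.apply (.inl (i, c) : HypIndex n (catalanValues m₁ m₂) m₃) X ∣
        HypIndex.apply (.inl (i, c) : HypIndex n (catalanValues m₁ m₂) m₃) g) := by
    intro i c a ha
    rw [← HypIndex.two_mul_apply_inl (m := m₃) i c ha,
      ← HypIndex.two_mul_apply_inl (m := m₃) i c ha,
      mul_dvd_mul_iff_left h2]
  have hneg : ∀ (a : ℂ) (p q : MvPolynomial (Fin (n + 1)) ℂ),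
      p + MvPolynomial.C a * q = p - MvPolynomial.C (-a) * q := fun a p q => by
    rw [C_neg]; ring
  simp only [DcBCCat, Set.mem_ofPred_eq]
  refine and_congr_right fun _ => ⟨fun ⟨hint, hhalf, hpair⟩ h => ?_, fun H => ⟨?_, ?_, ?_⟩⟩
  · rcases h with ⟨i, ⟨c, hc⟩⟩ | ⟨⟨⟨i, j⟩, hij⟩, k⟩
    · rcases mem_catalanValues.1 hc with ⟨j, hj, rfl⟩ | ⟨j, hj, rfl⟩
      · rw [HypIndex.apply_inl, HypIndex.apply_inl]
        exact hint i j (abs_le.1 hj).1 (abs_le.1 hj).2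
      · rcases le_or_gt 0 j with h0 | h0
        · lift j to ℕ using h0
          rw [← hscale i _ (2 * ((j + 1 : ℕ) : ℂ) - 1) (by push_cast; ring)]
          exact (hhalf i (j + 1) (by omega) (by omega)).1
        · obtain ⟨l, rfl⟩ : ∃ l : ℕ, j = -l := ⟨j.natAbs, by omega⟩
          rw [← hscale i _ (-(2 * (l : ℂ) - 1)) (by push_cast; ring), ← hneg, ← hneg]
          exact (hhalf i l (by omega) (by omega)).2
    · have hk := Finset.mem_Icc.1 k.2
      rcases lt_or_gt_of_ne hij with hlt | hlt
      · rw [HypIndex.apply_inr_of_lt hlt, HypIndex.apply_inr_of_lt hlt]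
        exact (hpair i j hlt k hk.1 hk.2).1
      · rw [HypIndex.apply_inr_of_gt hlt, HypIndex.apply_inr_of_gt hlt]
        exact (hpair j i hlt k hk.1 hk.2).2
  · intro i j hj hj'
    simpa only [HypIndex.apply_inl] using
      H (.inl (i, ⟨j, mem_catalanValues.2 (Or.inl ⟨j, abs_le.2 ⟨hj, hj'⟩, rfl⟩)⟩))
  · intro i j hj hj'
    rw [hneg, hneg]
    constructor
    · rw [hscale i ⟨((j - 1 : ℤ) : ℂ) + 1 / 2,
        mem_catalanValues.2 (Or.inr ⟨j - 1, by omega, rfl⟩)⟩ _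
        (by push_cast; ring)]
      exact H _
    · rw [hscale i ⟨((-j : ℤ) : ℂ) + 1 / 2, mem_catalanValues.2 (Or.inr ⟨-j, by omega, rfl⟩)⟩ _
        (by push_cast; ring)]
      exact H _
  · intro i j hij k hk hk'
    have hk : k ∈ Finset.Icc (-(m₃ : ℤ)) m₃ := Finset.mem_Icc.2 ⟨hk, hk'⟩
    constructor
    · simpa only [HypIndex.apply_inr_of_lt hij] using H (.inr (⟨(i, j), hij.ne⟩, ⟨k, hk⟩))
    · simpa only [HypIndex.apply_inr_of_gt hij] using H (.inr (⟨(j, i), hij.ne'⟩, ⟨k, hk⟩))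

end Cone

/-- the cone `cBCCat` of the extended Catalan arrangement of type `BC_N`
is a free arrangement: its module of logarithmic vector fields is a free
`ℂ[x_1,…,x_N,z]`-module of rank `N+1`. -/
theorem stmt_19 (N : ℕ) (hN : 2 ≤ N) (m1 m2 m3 : ℕ) :
    ∃ θ : Fin (N + 1) → (Fin (N + 1) → MvPolynomial (Fin (N + 1)) ℂ),
      (∀ k, θ k ∈ DcBCCat N m1 m2 m3) ∧
      (∀ g ∈ DcBCCat N m1 m2 m3,
        ∃ c : Fin (N + 1) → MvPolynomial (Fin (N + 1)) ℂ, ∀ i, g i = ∑ k, c k * θ k i) ∧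
      (∀ c : Fin (N + 1) → MvPolynomial (Fin (N + 1)) ℂ,
        (∀ i, (∑ k, c k * θ k i) = 0) → ∀ k, c k = 0) := by
  obtain ⟨θ, hθ⟩ := exists_isEquivBasis m3 N m1 m2
  obtain ⟨d, hd⟩ : ∃ d : Fin N → ℕ, ∀ k, (d k : ℤ) = basisDeg N (m1 + m2) m3 k :=
    ⟨fun k => (basisDeg N (m1 + m2) m3 k).toNat, fun k => Int.toNat_of_nonneg (by
      have : (0 : ℤ) ≤ 2 * m3 * ((N : ℤ) - 1) := mul_nonneg (by positivity) (by omega)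
      unfold basisDeg; omega)⟩
  have hdeg : ∀ k i, DegLE (θ k i) (d k) := fun k i => hd k ▸ hθ.degLE k i
  set ψ : Fin N → Fin N → MvPolynomial (Fin (N + 1)) ℂ :=
    fun k i => homogenize (d k) (θ k i) with hψ
  have hψdvd : ∀ k (h : HypIndex N (catalanValues m1 m2) m3),
      X (Fin.castSucc h.lead) - h.rest Fin.castSucc (X (Fin.last N)) ∣
        ∑ i, h.weight (Fin (N + 1)) i * ψ k i :=
    fun k h => (hθ.equivLog k).form_dvd_homogenize (hdeg k) h
  have hψdet : Matrix.det (Matrix.of ψ) ≠ 0 := by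
    intro h0
    apply hθ.det_ne_zero
    have h1 := congrArg (restrictLast 1) h0
    rw [AlgHom.map_det, map_zero] at h1
    rw [← h1]
    congr 1
    ext1 k i
    exact (restrictLast_homogenize (hdeg k i)).symm
  have hX : (X (Fin.last N) : MvPolynomial (Fin (N + 1)) ℂ) ≠ 0 := X_ne_zero _
  refine ⟨Fin.cons X fun k => Fin.snoc (α := fun _ => MvPolynomial (Fin (N + 1)) ℂ) (ψ k) 0,
    ?_, ?_, ?_⟩
  · refine Fin.cases ?_ fun k => ?_
    · exact mem_DcBCCat_iff.2 ⟨dvd_rfl, fun h => dvd_rfl⟩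
    · refine mem_DcBCCat_iff.2 ⟨by simp, fun h => ?_⟩
      rw [h.apply_X]
      simpa [HypIndex.apply] using hψdvd k h
  · intro g hg
    obtain ⟨⟨a, ha⟩, hH⟩ := mem_DcBCCat_iff.1 hg
    obtain ⟨c, hc, -⟩ := saito_hypIndex (isConeVar_last N) ψ _
      (fun k i => (hdeg k i).homogenize) hψdvd
      (by simp only [hd]; rw [sum_basisDeg, card_catalanValues]; push_cast; rfl) hψdet
      (fun i => g (Fin.castSucc i) - a * X (Fin.castSucc i)) fun h => by
        rw [← h.apply_X]
        have : ∑ i, h.weight (Fin (N + 1)) i * (g (Fin.castSucc i) - a * X (Fin.castSucc i)) =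
            h.apply g - a * h.apply X := by
          simp only [HypIndex.apply, ha, mul_sub, Finset.sum_sub_distrib, Finset.mul_sum]
          simp only [mul_left_comm a]
          ring
        rw [this]
        exact dvd_sub (hH h) (Dvd.intro_left _ rfl)
    refine ⟨Fin.cons a c, fun i => ?_⟩
    rw [Fin.sum_univ_succ]
    refine Fin.lastCases ?_ (fun i => ?_) i
    · simp [ha, mul_comm]
    · simp only [Fin.cons_zero, Fin.cons_succ, Fin.snoc_castSucc]
      rw [← hc i]; ring
  · intro c hc
    have h0 : c 0 = 0 := by
      have := hc (Fin.last N)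
      rw [Fin.sum_univ_succ] at this
      simpa [hX] using this
    refine Fin.cases h0 (eq_zero_of_sum_eq_zero hψdet fun i => ?_)
    have := hc (Fin.castSucc i)
    rw [Fin.sum_univ_succ] at this
    simpa [h0] using this

end
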